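/- There exist constants c > 0, C > 0 and an integer N₀ such that the following holds for every integer N ≥ N₀ and every real α ∈ [1/3, 1/2]: if A ⊆ [N] is a subset such that for each prime p ≤ N^α the set A mod p is contained in an arithmetic progression S_p ⊆ ℤ/pℤ of length at most αp, then |A| ≤ C · N^{α−c}. -/

import Mathlib

/-- `A` reduced modulo `p`. -/
def modImage (A : Finset ℕ) (p : ℕ) : Finset (ZMod p) :=
  A.image (fun a => (Nat.cast a : ZMod p))

/-- `S` is contained in an arithmetic progression in `ZMod p` of length at most `t`. -/
def InAP {p : ℕ} (S : Finset (ZMod p)) (t : ℝ) : Prop :=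
  ∃ (L : ℕ) (x d : ZMod p), d ≠ 0 ∧ (L : ℝ) ≤ t ∧
    S ⊆ (Finset.range L).image (fun j => x + (Nat.cast j : ZMod p) * d)

/-- The primes `p ≤ x`. -/
noncomputable def primesUpTo (x : ℝ) : Finset ℕ :=
  (Finset.Ioc 0 ⌊x⌋₊).filter Nat.Prime

lemma mem_primesUpTo {x : ℝ} {p : ℕ} : p ∈ primesUpTo x ↔ p.Prime ∧ (p : ℝ) ≤ x := by
  unfold primesUpTo
  rw [Finset.mem_filter, Finset.mem_Ioc]
  constructor
  · rintro ⟨⟨h0, h1⟩, hp⟩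
    exact ⟨hp, (Nat.le_floor_iff' h0.ne').1 h1⟩
  · rintro ⟨hp, h⟩
    exact ⟨⟨hp.pos, (Nat.le_floor_iff' hp.pos.ne').2 h⟩, hp⟩

lemma sum_log_primesUpTo_le {x : ℝ} (hx : 0 ≤ x) :
    ∑ p ∈ primesUpTo x, Real.log p ≤ Real.log 4 * x :=
  Chebyshev.theta_le_log4_mul_x hx

lemma log_factorial_eq_sum (n : ℕ) :
    Real.log (n.factorial) =
      ∑ p ∈ primesUpTo n, (n.factorial.factorization p : ℝ) * Real.log p := by
  rw [Real.log_nat_eq_sum_factorization, Finsupp.sum]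
  apply Finset.sum_subset
  · intro p hp
    rw [Nat.support_factorization, Nat.mem_primeFactors] at hp
    rw [mem_primesUpTo]
    refine ⟨hp.1, ?_⟩
    exact_mod_cast (hp.1.dvd_factorial).1 hp.2.1
  · intro p _ hp
    rw [Finsupp.notMem_support_iff] at hp
    simp [hp]

lemma factorization_factorial_mul_le {p : ℕ} (hp : p.Prime) (n : ℕ) :
    (n.factorial.factorization p : ℝ) * (p - 1) ≤ n := by
  have := Fact.mk hp
  have h := sub_one_mul_padicValNat_factorial (p := p) n
  have h2 : (p - 1) * n.factorial.factorization p ≤ n := by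
    rw [Nat.factorization_def _ hp, h]
    exact Nat.sub_le _ _
  have h3 : (((p - 1) * n.factorial.factorization p : ℕ) : ℝ) ≤ n := by exact_mod_cast h2
  rw [Nat.cast_mul, Nat.cast_sub hp.one_le] at h3
  push_cast at h3
  linarith

lemma div_sub_one_le_factorization_factorial {p : ℕ} (hp : p.Prime) (n : ℕ) :
    (n : ℝ) / p - 1 ≤ n.factorial.factorization p := by
  have h1 : n / p ≤ n.factorial.factorization p := by
    rw [Nat.factorization_factorial hp (b := Nat.log p n + 2) (by omega)]
    have := Finset.single_le_sum (f := fun i => n / p ^ i)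
      (s := Finset.Ico 1 (Nat.log p n + 2)) (fun i _ => Nat.zero_le _)
      (Finset.mem_Ico.2 ⟨le_refl 1, by omega⟩)
    simpa using this
  have h2 : ((n / p : ℕ) : ℝ) ≤ n.factorial.factorization p := by exact_mod_cast h1
  have h3 : (n : ℝ) / p < (n / p : ℕ) + 1 := by
    rw [div_lt_iff₀ (by exact_mod_cast hp.pos)]
    have : n < (n / p + 1) * p := by
      have h := Nat.lt_mul_div_succ n hp.pos
      calc n < p * (n / p + 1) := h
        _ = _ := by ring
    exact_mod_cast this
  linarith

lemma exists_bound_sum_log_div_mul_sub_one :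
    ∃ K : ℝ, 0 ≤ K ∧ ∀ x : ℝ, ∑ p ∈ primesUpTo x, Real.log p / (p * (p - 1)) ≤ K := by
  have hs : Summable fun n : ℕ => (4 : ℝ) * ((n : ℝ) ^ (3 / 2 : ℝ))⁻¹ :=
    (Real.summable_nat_rpow_inv.2 (by norm_num)).mul_left 4
  refine ⟨∑' n : ℕ, (4 : ℝ) * ((n : ℝ) ^ (3 / 2 : ℝ))⁻¹,
    tsum_nonneg fun n => by positivity, fun x => ?_⟩
  refine le_trans (Finset.sum_le_sum fun p hp => ?_)
    (hs.sum_le_tsum (primesUpTo x) fun n _ => by positivity)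
  have hp2 : (2 : ℝ) ≤ p := by exact_mod_cast (mem_primesUpTo.1 hp).1.two_le
  have h1 : Real.log p ≤ (p : ℝ) ^ (1 / 2 : ℝ) / (1 / 2) :=
    Real.log_le_rpow_div (by linarith) (by norm_num)
  have h2 : (p : ℝ) ^ (1 / 2 : ℝ) * (p : ℝ) ^ (3 / 2 : ℝ) = p * p := by
    rw [← Real.rpow_add (by linarith)]
    norm_num
    ring
  have h3 : (0 : ℝ) < (p : ℝ) ^ (3 / 2 : ℝ) := by positivity
  rw [div_le_iff₀ (by nlinarith), mul_assoc, inv_mul_eq_div, ← mul_div_assoc, le_div_iff₀ h3]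
  have : Real.log p * (p : ℝ) ^ (3 / 2 : ℝ) ≤ 2 * (p * p) := by
    rw [← h2]
    nlinarith
  nlinarith

/-- Mertens' first theorem up to a bounded error, together with the boundedness of
`∑ log p / p ^ 2`. -/
lemma exists_mertens_constant :
    ∃ K : ℝ, 1 ≤ K ∧ ∀ x : ℝ, 1 ≤ x →
      Real.log x - K ≤ ∑ p ∈ primesUpTo x, Real.log p / p ∧
      ∑ p ∈ primesUpTo x, Real.log p / p ≤ Real.log x + K ∧
      ∑ p ∈ primesUpTo x, Real.log p / (p : ℝ) ^ 2 ≤ K := by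
  obtain ⟨K, hK0, hK⟩ := exists_bound_sum_log_div_mul_sub_one
  refine ⟨K + 2, by linarith, fun x hx => ?_⟩
  obtain ⟨n, hn⟩ : ∃ n, n = ⌊x⌋₊ := ⟨_, rfl⟩
  have hn1 : 1 ≤ n := by rw [hn]; exact (Nat.one_le_floor_iff x).2 hx
  have hnR : (1 : ℝ) ≤ n := by exact_mod_cast hn1
  have hnx : (n : ℝ) ≤ x := by rw [hn]; exact Nat.floor_le (by linarith)
  have hxn : x < n + 1 := by rw [hn]; exact Nat.lt_floor_add_one x
  have hset : primesUpTo x = primesUpTo n := by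
    unfold primesUpTo
    rw [Nat.floor_natCast, hn]
  have hlogn : Real.log n ≤ Real.log x := Real.log_le_log (by linarith) hnx
  have hlogx : Real.log x ≤ Real.log n + 1 := by
    have h2 : Real.log x ≤ Real.log (2 * n) := Real.log_le_log (by linarith) (by linarith)
    rw [Real.log_mul (by norm_num) (by linarith)] at h2
    have := Real.log_two_lt_d9
    linarith
  have hprime : ∀ p ∈ primesUpTo (n : ℝ), (2 : ℝ) ≤ p := fun p hp => by
    exact_mod_cast (mem_primesUpTo.1 hp).1.two_le
  have hlog : ∀ p ∈ primesUpTo (n : ℝ), 0 ≤ Real.log p := fun p hp =>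
    Real.log_nonneg (by linarith [hprime p hp])
  have hfac_lower : n * Real.log n - n ≤ Real.log n.factorial := by
    have h := Real.pow_div_factorial_le_exp (n : ℝ) (by linarith) n
    have hf : (0 : ℝ) < n.factorial := by exact_mod_cast n.factorial_pos
    have h2 := Real.log_le_log (by positivity) h
    rw [Real.log_div (by positivity) hf.ne', Real.log_pow, Real.log_exp] at h2
    linarith
  have hfac_upper : Real.log n.factorial ≤ n * Real.log n := by
    rw [← Real.log_pow]
    apply Real.log_le_log (by exact_mod_cast n.factorial_pos)
    exact_mod_cast Nat.factorial_le_pow n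
  rw [log_factorial_eq_sum] at hfac_lower hfac_upper
  have hlow : (∑ p ∈ primesUpTo (n : ℝ), (n.factorial.factorization p : ℝ) * Real.log p) ≤
      n * ∑ p ∈ primesUpTo (n : ℝ), (Real.log p / p + Real.log p / (p * (p - 1))) := by
    rw [Finset.mul_sum]
    refine Finset.sum_le_sum fun p hp => ?_
    have h2 := hprime p hp
    have h1 := factorization_factorial_mul_le (mem_primesUpTo.1 hp).1 n
    have h3 : Real.log p / p + Real.log p / (p * (p - 1)) = Real.log p / (p - 1) := by
      have : (p : ℝ) - 1 ≠ 0 := by linarith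
      field_simp
      ring
    rw [h3, ← mul_div_assoc, le_div_iff₀ (by linarith)]
    have := mul_le_mul_of_nonneg_right h1 (hlog p hp)
    linarith
  have hup : n * (∑ p ∈ primesUpTo (n : ℝ), Real.log p / p) -
      ∑ p ∈ primesUpTo (n : ℝ), Real.log p ≤
      ∑ p ∈ primesUpTo (n : ℝ), (n.factorial.factorization p : ℝ) * Real.log p := by
    rw [Finset.mul_sum, ← Finset.sum_sub_distrib]
    refine Finset.sum_le_sum fun p hp => ?_
    have h1 := div_sub_one_le_factorization_factorial (mem_primesUpTo.1 hp).1 n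
    have := mul_le_mul_of_nonneg_right h1 (hlog p hp)
    have h3 : (n : ℝ) * (Real.log p / p) - Real.log p = (n / p - 1) * Real.log p := by ring
    linarith
  have htheta := sum_log_primesUpTo_le (x := n) (by linarith)
  have hlog4 : Real.log 4 ≤ 2 := by
    have : Real.log 4 = 2 * Real.log 2 := by
      rw [show (4 : ℝ) = 2 ^ 2 by norm_num, Real.log_pow]; norm_num
    have := Real.log_two_lt_d9
    linarith
  rw [Finset.sum_add_distrib] at hlow
  rw [hset]
  have hKn := hK n
  refine ⟨?_, ?_, ?_⟩
  · have : n * (Real.log n - 1) ≤ n * ((∑ p ∈ primesUpTo (n : ℝ), Real.log p / p) +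
        ∑ p ∈ primesUpTo (n : ℝ), Real.log p / (p * (p - 1))) := by linarith
    have := le_of_mul_le_mul_left this (by linarith)
    linarith
  · have : n * (∑ p ∈ primesUpTo (n : ℝ), Real.log p / p) ≤ n * (Real.log n + 2) := by
      nlinarith
    have := le_of_mul_le_mul_left this (by linarith)
    linarith
  · refine le_trans (Finset.sum_le_sum fun p hp => ?_) (le_trans hKn (by linarith))
    have := hprime p hp
    exact div_le_div_of_nonneg_left (hlog p hp) (by nlinarith) (by nlinarith)

/-- The number of ordered pairs of elements of `A` that are congruent modulo `p`. -/
def collisions (A : Finset ℕ) (p : ℕ) : ℕ :=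
  ((A ×ˢ A).filter fun x => (x.1 : ZMod p) = x.2).card

lemma sq_card_le_mul_collisions (A : Finset ℕ) (p : ℕ) :
    (A.card : ℝ) ^ 2 ≤ (modImage A p).card * (collisions A p : ℝ) := by
  have h1 : A.card = ∑ x ∈ modImage A p, (A.filter fun a : ℕ => (a : ZMod p) = x).card :=
    Finset.card_eq_sum_card_fiberwise fun a ha => Finset.mem_image_of_mem _ ha
  have h2 : collisions A p =
      ∑ x ∈ modImage A p, (A.filter fun a : ℕ => (a : ZMod p) = x).card ^ 2 := by
    unfold collisions
    rw [Finset.card_eq_sum_card_fiberwise (f := fun x : ℕ × ℕ => (x.1 : ZMod p))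
      (t := modImage A p)]
    · refine Finset.sum_congr rfl fun x _ => ?_
      rw [sq, ← Finset.card_product]
      congr 1
      ext ⟨a, b⟩
      simp only [Finset.mem_filter, Finset.mem_product]
      constructor
      · rintro ⟨⟨⟨ha, hb⟩, hab⟩, hx⟩
        exact ⟨⟨ha, hx⟩, hb, hab ▸ hx⟩
      · rintro ⟨⟨ha, hx⟩, hb, hbx⟩
        exact ⟨⟨⟨ha, hb⟩, hx.trans hbx.symm⟩, hx⟩
    · rintro ⟨a, b⟩ hab
      simp only [Finset.coe_filter, Finset.mem_product, Set.mem_ofPred_eq] at hab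
      exact Finset.mem_image_of_mem _ hab.1.1
  have h3 := sq_sum_le_card_mul_sum_sq (s := modImage A p)
    (f := fun x => ((A.filter fun a : ℕ => (a : ZMod p) = x).card : ℝ))
  rw [h1, h2]
  push_cast
  exact h3

/-- Gallagher's larger sieve inequality, before inserting lower bounds for the collisions. -/
lemma larger_sieve {A : Finset ℕ} {N : ℕ} (hA : A ⊆ Finset.Icc 1 N) (P : Finset ℕ)
    (hP : ∀ p ∈ P, p.Prime) :
    ∑ p ∈ P, Real.log p * ((collisions A p : ℝ) - A.card) ≤ (A.card : ℝ) ^ 2 * Real.log N := by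
  have key : ∀ p ∈ P, ((collisions A p : ℝ) - A.card) =
      ∑ x ∈ A.offDiag, if (x.1 : ZMod p) = x.2 then (1 : ℝ) else 0 := by
    intro p _
    unfold collisions
    rw [← Finset.sum_filter, Finset.sum_const, nsmul_eq_mul, mul_one, sub_eq_iff_eq_add]
    have hd : Disjoint (A.offDiag.filter fun x => (x.1 : ZMod p) = x.2) A.diag :=
      (Finset.disjoint_diag_offDiag A).symm.mono_left (Finset.filter_subset _ _)
    rw [← Finset.diag_card A, ← Nat.cast_add, ← Finset.card_union_of_disjoint hd]
    congr 2
    ext ⟨a, b⟩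
    simp only [Finset.mem_filter, Finset.mem_product, Finset.mem_union, Finset.mem_offDiag,
      Finset.mem_diag]
    constructor
    · rintro ⟨⟨ha, hb⟩, h⟩
      by_cases hab : a = b
      · exact Or.inr ⟨ha, hab⟩
      · exact Or.inl ⟨⟨ha, hb, hab⟩, h⟩
    · rintro (⟨⟨ha, hb, -⟩, h⟩ | ⟨ha, rfl⟩)
      · exact ⟨⟨ha, hb⟩, h⟩
      · exact ⟨⟨ha, ha⟩, rfl⟩
  rw [Finset.sum_congr rfl fun p hp => by rw [key p hp, Finset.mul_sum], Finset.sum_comm]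
  have hterm : ∀ x ∈ A.offDiag,
      ∑ p ∈ P, Real.log p * (if (x.1 : ZMod p) = x.2 then (1 : ℝ) else 0) ≤ Real.log N := by
    rintro ⟨a, b⟩ hx
    obtain ⟨ha, hb, hab⟩ := Finset.mem_offDiag.1 hx
    have ha' := Finset.mem_Icc.1 (hA ha)
    have hb' := Finset.mem_Icc.1 (hA hb)
    simp only at hab ⊢
    simp only [mul_ite, mul_one, mul_zero]
    rw [← Finset.sum_filter, ← Real.log_prod fun p hp => by
      exact_mod_cast (hP p (Finset.mem_filter.1 hp).1).ne_zero]
    obtain ⟨m, hm⟩ : ∃ m, m = ((a : ℤ) - b).natAbs := ⟨_, rfl⟩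
    have hdvd : ∏ p ∈ P.filter (fun p => (a : ZMod p) = b), p ∣ m := by
      refine Finset.prod_primes_dvd m (fun p hp => (hP p (Finset.mem_filter.1 hp).1).prime) ?_
      intro p hp
      have h := (Finset.mem_filter.1 hp).2
      rw [hm, ← Int.natCast_dvd, ← ZMod.intCast_zmod_eq_zero_iff_dvd]
      push_cast
      exact sub_eq_zero.2 h
    have hm0 : 0 < m := by omega
    have hmN : m ≤ N := by omega
    have hle := (Nat.le_of_dvd hm0 hdvd).trans hmN
    rw [← Nat.cast_prod]
    apply Real.log_le_log
    · exact_mod_cast Finset.prod_pos fun p hp => (hP p (Finset.mem_filter.1 hp).1).pos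
    · exact_mod_cast hle
  refine (Finset.sum_le_sum hterm).trans ?_
  rw [Finset.sum_const, nsmul_eq_mul]
  apply mul_le_mul_of_nonneg_right _ (Real.log_natCast_nonneg N)
  rw [Finset.offDiag_card]
  have : A.card * A.card - A.card ≤ A.card ^ 2 := by rw [sq]; exact Nat.sub_le _ _
  exact_mod_cast this

/-- A set that occupies at most `β p + 4` classes modulo each prime `p ≤ T` has at most `T`
elements, when `T` is a bit larger than `N ^ β`. -/
lemma card_le_of_card_modImage_le {K : ℝ}
    (hK : ∀ x : ℝ, 1 ≤ x →
      Real.log x - K ≤ ∑ p ∈ primesUpTo x, Real.log p / p ∧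
      ∑ p ∈ primesUpTo x, Real.log p / p ≤ Real.log x + K ∧
      ∑ p ∈ primesUpTo x, Real.log p / (p : ℝ) ^ 2 ≤ K)
    {B : Finset ℕ} {N : ℕ} (hB : B ⊆ Finset.Icc 1 N) {T β : ℝ} (hT : 1 ≤ T) (hβ : 0 < β)
    (hmod : ∀ p : ℕ, p.Prime → (p : ℝ) ≤ T → ((modImage B p).card : ℝ) ≤ β * p + 4)
    (hlarge : Real.log N + Real.log 4 ≤ (Real.log T - K) / β - 4 * K / β ^ 2) :
    (B.card : ℝ) ≤ T := by
  obtain ⟨hK1, -, hK2⟩ := hK T hT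
  have hs := larger_sieve hB (primesUpTo T) fun p hp => (mem_primesUpTo.1 hp).1
  have hθ := sum_log_primesUpTo_le (x := T) (by linarith)
  obtain ⟨Z, hZ⟩ : ∃ Z : ℝ, Z = B.card := ⟨_, rfl⟩
  have hZ0 : 0 ≤ Z := by rw [hZ]; positivity
  rw [← hZ] at hs ⊢
  have hlow : ∑ p ∈ primesUpTo T, (Z ^ 2 * (Real.log p / p) / β -
      4 * (Z ^ 2 * (Real.log p / (p : ℝ) ^ 2)) / β ^ 2 - Real.log p * Z) ≤
      Z ^ 2 * Real.log N := by
    refine le_trans (Finset.sum_le_sum fun p hp => ?_) hs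
    obtain ⟨hpp, hpT⟩ := mem_primesUpTo.1 hp
    have hp0 : (0 : ℝ) < p := by exact_mod_cast hpp.pos
    have hlog : 0 ≤ Real.log p := Real.log_natCast_nonneg p
    have h1 := sq_card_le_mul_collisions B p
    rw [← hZ] at h1
    have h2 : Z ^ 2 ≤ (β * p + 4) * (collisions B p : ℝ) :=
      h1.trans (mul_le_mul_of_nonneg_right (hmod p hpp hpT) (by positivity))
    have h3 : Z ^ 2 * (1 / (β * p) - 4 / (β * p) ^ 2) ≤ collisions B p := by
      rw [← div_le_iff₀' (by positivity)] at h2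
      refine le_trans ?_ h2
      rw [div_eq_mul_one_div (Z ^ 2)]
      apply mul_le_mul_of_nonneg_left _ (by positivity)
      rw [le_div_iff₀ (by positivity)]
      have : (1 / (β * p) - 4 / (β * p) ^ 2) * (β * p + 4) = 1 - 16 / (β * p) ^ 2 := by
        field_simp
        ring
      rw [this]
      have : 0 ≤ 16 / (β * p) ^ 2 := by positivity
      linarith
    have h4 := mul_le_mul_of_nonneg_left h3 hlog
    have h5 : Z ^ 2 * (Real.log p / p) / β -
      4 * (Z ^ 2 * (Real.log p / (p : ℝ) ^ 2)) / β ^ 2 =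
        Real.log p * (Z ^ 2 * (1 / (β * p) - 4 / (β * p) ^ 2)) := by
      field_simp
    rw [h5, mul_sub]
    linarith
  rw [Finset.sum_sub_distrib, Finset.sum_sub_distrib, ← Finset.sum_div, ← Finset.sum_div,
    ← Finset.mul_sum, ← Finset.mul_sum, ← Finset.mul_sum, ← Finset.sum_mul] at hlow
  have e1 : Z ^ 2 * ((Real.log T - K) / β) ≤
      Z ^ 2 * (∑ p ∈ primesUpTo T, Real.log p / p) / β := by
    rw [mul_div_assoc]
    gcongr
  have e2 : 4 * (Z ^ 2 * ∑ p ∈ primesUpTo T, Real.log p / (p : ℝ) ^ 2) / β ^ 2 ≤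
      Z ^ 2 * (4 * K / β ^ 2) := by
    rw [← mul_div_assoc]
    apply div_le_div_of_nonneg_right _ (by positivity)
    nlinarith [sq_nonneg Z]
  have e3 := mul_le_mul_of_nonneg_right hθ hZ0
  have e4 := mul_le_mul_of_nonneg_left hlarge (sq_nonneg Z)
  have hl4 : 0 < Real.log 4 := Real.log_pos (by norm_num)
  have e5 : Real.log 4 * (Z * Z) ≤ Real.log 4 * (T * Z) := by nlinarith
  have e6 := le_of_mul_le_mul_left e5 hl4
  by_contra hlt
  push Not at hlt
  nlinarith

lemma card_filter_mul_mem_Ico_le (L : ℕ) {k : ℕ} (hk : 0 < k) {u v : ℤ} (huv : u ≤ v) :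
    (((Finset.range L).filter fun j : ℕ => u ≤ (k : ℤ) * j ∧ (k : ℤ) * j < v).card : ℝ) ≤
      ((v : ℝ) - u) / k + 1 := by
  obtain ⟨S, hS⟩ : ∃ S, S = (Finset.range L).filter
    fun j : ℕ => u ≤ (k : ℤ) * j ∧ (k : ℤ) * j < v := ⟨_, rfl⟩
  rw [← hS]
  have hkR : (0 : ℝ) < k := by exact_mod_cast hk
  have huvR : (u : ℝ) ≤ v := by exact_mod_cast huv
  rcases S.eq_empty_or_nonempty with h | h
  · rw [h, Finset.card_empty, Nat.cast_zero]
    have : 0 ≤ ((v : ℝ) - u) / k := div_nonneg (by linarith) hkR.le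
    linarith
  · have hmin := S.min'_mem h
    have hmax := S.max'_mem h
    have hsub : S ⊆ Finset.Icc (S.min' h) (S.max' h) := fun j hj =>
      Finset.mem_Icc.2 ⟨S.min'_le j hj, S.le_max' j hj⟩
    have hcard := Finset.card_le_card hsub
    rw [Nat.card_Icc] at hcard
    have hle := S.min'_le _ hmax
    obtain ⟨a, ha⟩ : ∃ a, a = S.min' h := ⟨_, rfl⟩
    obtain ⟨b, hb⟩ : ∃ b, b = S.max' h := ⟨_, rfl⟩
    have hS' : ∀ j ∈ S, u ≤ (k : ℤ) * j ∧ (k : ℤ) * j < v := fun j hj => by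
      rw [hS] at hj
      exact (Finset.mem_filter.1 hj).2
    have hamem := hS' _ hmin
    have hbmem := hS' _ hmax
    rw [← ha] at hle hcard hamem
    rw [← hb] at hle hcard hbmem
    have h1 : (S.card : ℝ) ≤ b - a + 1 := by
      have : S.card + a ≤ b + 1 := by omega
      have : ((S.card + a : ℕ) : ℝ) ≤ ((b + 1 : ℕ) : ℝ) := by exact_mod_cast this
      push_cast at this
      linarith
    have h2 : (u : ℝ) ≤ k * a := by exact_mod_cast hamem.1
    have h3 : (k : ℝ) * b < v := by exact_mod_cast hbmem.2
    have h4 : (b : ℝ) - a ≤ ((v : ℝ) - u) / k := by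
      rw [le_div_iff₀ hkR]
      nlinarith
    linarith

/-- If the dilate `k * [0, L)` wraps at most twice around `ZMod p`, then about `2 / k` of its
elements lie in any given interval of length `L`. -/
lemma card_filter_mul_eq_add_le {p k L : ℕ} [NeZero p] (hk : 0 < k) (hL : L ≤ p)
    (hkL : k * L ≤ 2 * p) (c : ZMod p) :
    (((Finset.range L).filter
      fun j : ℕ => ∃ i ∈ Finset.range L, (k : ZMod p) * j = i + c).card : ℝ) ≤
      2 * L / k + 3 := by
  obtain ⟨s, hs⟩ : ∃ s : ℤ, s = c.val := ⟨_, rfl⟩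
  have hs0 : 0 ≤ s := by omega
  have hsp : s < p := by rw [hs]; exact_mod_cast ZMod.val_lt c
  have hsc : (s : ZMod p) = c := by rw [hs]; simp
  obtain ⟨I, hI⟩ : ∃ I : ℤ → ℤ → Finset ℕ, I = fun u v => (Finset.range L).filter
    fun j : ℕ => u ≤ (k : ℤ) * j ∧ (k : ℤ) * j < v := ⟨_, rfl⟩
  have hsub : (Finset.range L).filter
      (fun j : ℕ => ∃ i ∈ Finset.range L, (k : ZMod p) * j = i + c) ⊆
      I 0 (max 0 (s + L - p)) ∪ (I s (s + L) ∪ I (s + p) (min (s + p + L) (2 * p))) := by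
    intro j hj
    rw [Finset.mem_filter] at hj
    obtain ⟨hjL, i, hi, hij⟩ := hj
    have hiL := Finset.mem_range.1 hi
    have hjL' := Finset.mem_range.1 hjL
    have hz : (((k : ℤ) * j - (i + s) : ℤ) : ZMod p) = 0 := by
      push_cast
      rw [hsc, hij, sub_self]
    rw [ZMod.intCast_zmod_eq_zero_iff_dvd] at hz
    obtain ⟨m, hm⟩ := hz
    have hkj : (k : ℤ) * j < 2 * p := by
      have h1 : k * j < k * L := Nat.mul_lt_mul_of_pos_left hjL' hk
      exact_mod_cast lt_of_lt_of_le h1 hkL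
    have hkj0 : 0 ≤ (k : ℤ) * j := by positivity
    have hp0 : (0 : ℤ) < p := by omega
    have hm1 : m < 2 := by
      by_contra h
      push Not at h
      nlinarith
    have hm2 : -2 < m := by
      by_contra h
      push Not at h
      nlinarith
    simp only [hI, Finset.mem_union, Finset.mem_filter]
    have hcase : m = -1 ∨ m = 0 ∨ m = 1 := by omega
    rcases hcase with rfl | rfl | rfl
    · left
      exact ⟨hjL, hkj0, by omega⟩
    · right; left
      exact ⟨hjL, by omega, by omega⟩
    · right; right
      exact ⟨hjL, by omega, by omega⟩
  have hcard := Finset.card_le_card hsub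
  have hun1 := Finset.card_union_le (I 0 (max 0 (s + L - p)))
    (I s (s + L) ∪ I (s + p) (min (s + p + L) (2 * p)))
  have hun2 := Finset.card_union_le (I s (s + L)) (I (s + p) (min (s + p + L) (2 * p)))
  have b1 := card_filter_mul_mem_Ico_le L hk (u := 0) (v := max 0 (s + L - p)) (by omega)
  have b2 := card_filter_mul_mem_Ico_le L hk (u := s) (v := s + L) (by omega)
  have b3 := card_filter_mul_mem_Ico_le L hk (u := s + p) (v := min (s + p + L) (2 * p))
    (by omega)
  have hlen : ((max 0 (s + L - p) : ℤ) : ℝ) - (0 : ℤ) + (((s + L : ℤ) : ℝ) - s) +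
      (((min (s + p + L) (2 * p) : ℤ) : ℝ) - (s + p : ℤ)) = 2 * L := by
    have : max 0 (s + L - p) - 0 + (s + L - s) + (min (s + p + L) (2 * p) - (s + p)) =
      2 * (L : ℤ) := by omega
    exact_mod_cast this
  have htot : (((Finset.range L).filter
      fun j : ℕ => ∃ i ∈ Finset.range L, (k : ZMod p) * j = i + c).card : ℝ) ≤
      (I 0 (max 0 (s + L - p))).card + (I s (s + L)).card +
        (I (s + p) (min (s + p + L) (2 * p))).card := by
    have hN := hcard.trans (hun1.trans (Nat.add_le_add_left hun2 _))
    rw [← add_assoc] at hN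
    have hN' := (Nat.cast_le (α := ℝ)).2 hN
    rw [Nat.cast_add, Nat.cast_add] at hN'
    exact hN'
  simp only [hI] at htot
  rw [← hlen, add_div, add_div]
  linarith

/-- The elements `a ∈ A` with `k * a - y ∈ A`. -/
def fibre (A : Finset ℕ) (k : ℕ) (y : ℤ) : Finset ℕ :=
  A.filter fun a => ∃ b ∈ A, (k : ℤ) * a - b = y

lemma card_modImage_fibre_le {A : Finset ℕ} {p k L : ℕ} (hp : p.Prime) (hk : 0 < k)
    {x d : ZMod p} (hd : d ≠ 0) (hL : L ≤ p) (hkL : k * L ≤ 2 * p)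
    (hA : modImage A p ⊆ (Finset.range L).image (fun j => x + (Nat.cast j : ZMod p) * d))
    (y : ℤ) :
    ((modImage (fibre A k y) p).card : ℝ) ≤ 2 * L / k + 3 := by
  have := Fact.mk hp
  refine le_trans ?_ (card_filter_mul_eq_add_le hk hL hkL ((y + x - k * x) * d⁻¹))
  have hmem : ∀ a ∈ A, ∃ j ∈ Finset.range L, x + (j : ZMod p) * d = a := fun a ha =>
    Finset.mem_image.1 (hA (Finset.mem_image_of_mem _ ha))
  have hsub : modImage (fibre A k y) p ⊆ ((Finset.range L).filter
      fun j : ℕ => ∃ i ∈ Finset.range L,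
        (k : ZMod p) * j = i + (y + x - k * x) * d⁻¹).image
      (fun j => x + (Nat.cast j : ZMod p) * d) := by
    intro z hz
    obtain ⟨a, ha, rfl⟩ := Finset.mem_image.1 hz
    obtain ⟨haA, b, hbA, hab⟩ := Finset.mem_filter.1 ha
    obtain ⟨j, hj, hja⟩ := hmem a haA
    obtain ⟨i, hi, hib⟩ := hmem b hbA
    refine Finset.mem_image.2 ⟨j, Finset.mem_filter.2 ⟨hj, i, hi, ?_⟩, hja⟩
    have h : (k : ZMod p) * a - b = y := by
      have := congrArg (fun n : ℤ => (n : ZMod p)) hab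
      push_cast at this
      exact this
    rw [← hja, ← hib] at h
    rw [← h]
    field_simp
    ring
  exact_mod_cast (Finset.card_le_card hsub).trans Finset.card_image_le

/-- The additive character `x ↦ exp (2 π i x)`. -/
noncomputable def unitExp (x : ℝ) : ℂ :=
  Complex.exp (Complex.I * ((2 * Real.pi * x : ℝ) : ℂ))

lemma unitExp_add (x y : ℝ) : unitExp (x + y) = unitExp x * unitExp y := by
  unfold unitExp
  rw [← Complex.exp_add]
  congr 1
  push_cast
  ring

lemma norm_unitExp (x : ℝ) : ‖unitExp x‖ = 1 := by
  unfold unitExp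
  rw [mul_comm]
  exact Complex.norm_exp_ofReal_mul_I _

lemma unitExp_zero : unitExp 0 = 1 := by
  simp [unitExp]

lemma unitExp_intCast (n : ℤ) : unitExp n = 1 := by
  unfold unitExp
  rw [Complex.exp_eq_one_iff]
  exact ⟨n, by push_cast; ring⟩

lemma unitExp_natCast_mul (n : ℕ) (x : ℝ) : unitExp (n * x) = unitExp x ^ n := by
  unfold unitExp
  rw [← Complex.exp_nat_mul]
  congr 1
  push_cast
  ring

lemma star_unitExp (x : ℝ) : starRingEnd ℂ (unitExp x) = unitExp (-x) := by
  unfold unitExp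
  rw [← Complex.exp_conj]
  congr 1
  rw [map_mul, Complex.conj_I, Complex.conj_ofReal]
  push_cast
  ring

lemma unitExp_eq_of_sub_eq_intCast {x y : ℝ} {n : ℤ} (h : x - y = n) : unitExp x = unitExp y := by
  rw [show x = y + n by linarith, unitExp_add, unitExp_intCast, mul_one]

lemma norm_unitExp_sub_one (x : ℝ) : ‖unitExp x - 1‖ = 2 * |Real.sin (Real.pi * x)| := by
  unfold unitExp
  rw [Complex.norm_exp_I_mul_ofReal_sub_one, Real.norm_eq_abs, abs_mul, abs_two]
  congr 3
  ring

lemma norm_unitExp_sub_one_le (x : ℝ) : ‖unitExp x - 1‖ ≤ 2 * Real.pi * |x| := by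
  rw [norm_unitExp_sub_one]
  have h := Real.abs_sin_le_abs (x := Real.pi * x)
  rw [abs_mul, abs_of_pos Real.pi_pos] at h
  linarith

lemma four_mul_le_norm_unitExp_sub_one {x δ : ℝ} (n : ℤ) (hδ : 0 ≤ δ) (h1 : n + δ ≤ x)
    (h2 : x ≤ n + 1 - δ) : 4 * δ ≤ ‖unitExp x - 1‖ := by
  have hπ := Real.pi_pos
  rw [unitExp_eq_of_sub_eq_intCast (y := x - n) (n := n) (by ring), norm_unitExp_sub_one]
  obtain ⟨t, ht⟩ : ∃ t, t = x - n := ⟨_, rfl⟩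
  rw [← ht]
  rcases le_total t (1 / 2) with h | h
  · have := Real.mul_abs_le_abs_sin (x := Real.pi * t)
      (by rw [abs_of_nonneg (by apply mul_nonneg hπ.le; linarith)]; nlinarith)
    rw [abs_of_nonneg (a := Real.pi * t) (by apply mul_nonneg hπ.le; linarith)] at this
    have e : 2 / Real.pi * (Real.pi * t) = 2 * t := by field_simp
    linarith
  · have := Real.mul_abs_le_abs_sin (x := Real.pi * (1 - t))
      (by rw [abs_of_nonneg (by apply mul_nonneg hπ.le; linarith)]; nlinarith)
    rw [abs_of_nonneg (a := Real.pi * (1 - t)) (by apply mul_nonneg hπ.le; linarith)] at this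
    have e : 2 / Real.pi * (Real.pi * (1 - t)) = 2 * (1 - t) := by field_simp
    rw [show Real.pi * (1 - t) = Real.pi - Real.pi * t by ring, Real.sin_pi_sub] at this
    rw [show Real.pi * (1 - t) = Real.pi - Real.pi * t by ring] at e
    linarith

lemma norm_sum_unitExp_mul (M : ℕ) (x : ℝ) :
    ‖∑ n ∈ Finset.range M, unitExp (n * x)‖ * ‖unitExp x - 1‖ = ‖unitExp (M * x) - 1‖ := by
  simp_rw [unitExp_natCast_mul]
  rw [← norm_mul, geom_sum_mul]

lemma norm_sum_unitExp_neg (M : ℕ) (x : ℝ) :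
    ‖∑ n ∈ Finset.range M, unitExp (n * (-x))‖ = ‖∑ n ∈ Finset.range M, unitExp (n * x)‖ := by
  rw [← RCLike.norm_conj, map_sum]
  simp_rw [star_unitExp, mul_neg, neg_neg]

lemma norm_sum_unitExp_le (M : ℕ) {x : ℝ} (h0 : 0 < Int.fract x) :
    ‖∑ n ∈ Finset.range M, unitExp (n * x)‖ ≤
      (1 / Int.fract x + 1 / (1 - Int.fract x)) / 2 := by
  have h1 := Int.fract_lt_one x
  obtain ⟨t, ht⟩ : ∃ t, t = Int.fract x := ⟨_, rfl⟩
  have hx : x = ⌊x⌋ + t := by rw [ht, Int.floor_add_fract]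
  have h := norm_sum_unitExp_mul M x
  have h2 : ‖unitExp (M * x) - 1‖ ≤ 2 := by
    refine (norm_sub_le _ _).trans ?_
    rw [norm_unitExp, norm_one]
    norm_num
  rw [← ht] at h0 h1 ⊢
  have key : ∀ δ : ℝ, 0 < δ → δ ≤ t → δ ≤ 1 - t →
      ‖∑ n ∈ Finset.range M, unitExp (n * x)‖ ≤ 1 / δ / 2 := by
    intro δ hδ ha hb
    have h3 := four_mul_le_norm_unitExp_sub_one (x := x) ⌊x⌋ hδ.le (by linarith) (by linarith)
    rw [div_div, le_div_iff₀ (by linarith)]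
    have := mul_le_mul_of_nonneg_left h3
      (norm_nonneg (∑ n ∈ Finset.range M, unitExp (n * x)))
    nlinarith
  rcases le_total t (1 - t) with h3 | h3
  · refine (key t h0 le_rfl h3).trans ?_
    have : 0 < 1 / (1 - t) := by apply one_div_pos.2; linarith
    linarith
  · refine (key (1 - t) (by linarith) h3 le_rfl).trans ?_
    have : 0 < 1 / t := one_div_pos.2 h0
    linarith

/-- The reciprocals of the fractional parts of `1 / N`-separated points sum to `O(N log N)`. -/
lemma sum_one_div_fract_le {ι : Type*} (S : Finset ι) (t : ι → ℝ) {N : ℕ} (hN : 0 < N)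
    (h0 : ∀ s ∈ S, 1 / (N : ℝ) ≤ Int.fract (t s))
    (hsep : ∀ r ∈ S, ∀ s ∈ S, r ≠ s → ∀ n : ℤ, 1 / (N : ℝ) ≤ |t r - t s - n|) :
    ∑ s ∈ S, 1 / Int.fract (t s) ≤ N * (1 + Real.log N) := by
  have hNR : (0 : ℝ) < N := by exact_mod_cast hN
  obtain ⟨F, hF⟩ : ∃ F : ι → ℕ, ∀ s, F s = ⌊N * Int.fract (t s)⌋₊ := ⟨_, fun _ => rfl⟩
  have hle : ∀ s ∈ S, (F s : ℝ) ≤ N * Int.fract (t s) := fun s hs => by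
    rw [hF]
    exact Nat.floor_le (mul_nonneg hNR.le (Int.fract_nonneg _))
  have hpos : ∀ s ∈ S, 1 ≤ F s := fun s hs => by
    rw [hF, Nat.one_le_floor_iff]
    have := h0 s hs
    rwa [div_le_iff₀' hNR] at this
  have hltN : ∀ s ∈ S, F s ≤ N := fun s hs => by
    have h1 := hle s hs
    have h2 := Int.fract_lt_one (t s)
    have : (F s : ℝ) ≤ N := by nlinarith
    exact_mod_cast this
  have hinj : Set.InjOn F S := by
    intro r hr s hs hrs
    by_contra hne
    have h := hsep r hr s hs hne (⌊t r⌋ - ⌊t s⌋)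
    have e : t r - t s - ((⌊t r⌋ - ⌊t s⌋ : ℤ) : ℝ) = Int.fract (t r) - Int.fract (t s) := by
      unfold Int.fract
      push_cast
      ring
    rw [e, div_le_iff₀' hNR] at h
    rw [hF, hF] at hrs
    have a1 := Nat.floor_le (mul_nonneg hNR.le (Int.fract_nonneg (t r)))
    have a2 := Nat.lt_floor_add_one (N * Int.fract (t r))
    have a3 := Nat.floor_le (mul_nonneg hNR.le (Int.fract_nonneg (t s)))
    have a4 := Nat.lt_floor_add_one (N * Int.fract (t s))
    rw [hrs] at a1 a2
    have : |N * (Int.fract (t r) - Int.fract (t s))| < 1 := by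
      rw [abs_lt]
      constructor <;> linarith
    rw [abs_mul, abs_of_pos hNR] at this
    linarith
  calc ∑ s ∈ S, 1 / Int.fract (t s)
      ≤ ∑ s ∈ S, N * ((F s : ℝ))⁻¹ := by
        refine Finset.sum_le_sum fun s hs => ?_
        have h1 : (0 : ℝ) < F s := by exact_mod_cast hpos s hs
        have h2 := hle s hs
        have h3 : 0 < Int.fract (t s) := lt_of_lt_of_le (by positivity) (h0 s hs)
        rw [← div_eq_mul_inv, div_le_div_iff₀ h3 h1]
        linarith
    _ = N * ∑ m ∈ S.image F, ((m : ℝ))⁻¹ := by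
        rw [Finset.sum_image fun r hr s hs h => hinj hr hs h, Finset.mul_sum]
    _ ≤ N * ∑ m ∈ Finset.Icc 1 N, ((m : ℝ))⁻¹ := by
        apply mul_le_mul_of_nonneg_left _ hNR.le
        apply Finset.sum_le_sum_of_subset_of_nonneg
        · intro m hm
          obtain ⟨s, hs, rfl⟩ := Finset.mem_image.1 hm
          exact Finset.mem_Icc.2 ⟨hpos s hs, hltN s hs⟩
        · intro m _ _
          positivity
    _ ≤ N * (1 + Real.log N) := by
        apply mul_le_mul_of_nonneg_left _ hNR.le
        have h := harmonic_le_one_add_log N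
        rw [harmonic_eq_sum_Icc] at h
        push_cast at h
        exact h

/-- The dual large sieve inequality for `1 / N`-separated frequencies, up to a logarithm. -/
lemma dual_large_sieve {ι : Type*} (R : Finset ι) (φ : ι → ℝ) (c : ι → ℂ) {N : ℕ} (hN : 0 < N)
    (hsep : ∀ r ∈ R, ∀ s ∈ R, r ≠ s → ∀ n : ℤ, 1 / (N : ℝ) ≤ |φ r - φ s - n|) (M : ℕ) :
    ∑ n ∈ Finset.range M, ‖∑ r ∈ R, c r * unitExp (n * φ r)‖ ^ 2 ≤
      (M + N * (1 + Real.log N)) * ∑ r ∈ R, ‖c r‖ ^ 2 := by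
  classical
  have hNR : (0 : ℝ) < N := by exact_mod_cast hN
  obtain ⟨D, hD⟩ : ∃ D : ℝ → ℝ, ∀ x, D x = ‖∑ n ∈ Finset.range M, unitExp (n * x)‖ :=
    ⟨_, fun _ => rfl⟩
  have hDsymm : ∀ x, D (-x) = D x := fun x => by rw [hD, hD, norm_sum_unitExp_neg]
  have hD0 : ∀ x, 0 ≤ D x := fun x => by rw [hD]; positivity
  have hexp : ((∑ n ∈ Finset.range M, ‖∑ r ∈ R, c r * unitExp (n * φ r)‖ ^ 2 : ℝ) : ℂ) =
      ∑ r ∈ R, ∑ s ∈ R, c r * starRingEnd ℂ (c s) *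
        ∑ n ∈ Finset.range M, unitExp (n * (φ r - φ s)) := by
    push_cast
    simp_rw [← Complex.mul_conj', map_sum, Finset.sum_mul_sum, Finset.mul_sum]
    rw [Finset.sum_comm]
    refine Finset.sum_congr rfl fun r _ => ?_
    rw [Finset.sum_comm]
    refine Finset.sum_congr rfl fun s _ => Finset.sum_congr rfl fun n _ => ?_
    rw [map_mul, star_unitExp, mul_sub, sub_eq_add_neg, unitExp_add]
    ring
  have hrow : ∀ r ∈ R, ∑ s ∈ R, D (φ r - φ s) ≤ M + N * (1 + Real.log N) := by
    intro r hr
    rw [← Finset.add_sum_erase R _ hr]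
    have h1 : D (φ r - φ r) ≤ M := by
      rw [hD, sub_self]
      simp [unitExp_zero]
    refine add_le_add h1 ?_
    have hfr : ∀ s ∈ R.erase r, 1 / (N : ℝ) ≤ Int.fract (φ r - φ s) ∧
        1 / (N : ℝ) ≤ Int.fract (φ s - φ r) ∧
        Int.fract (φ s - φ r) = 1 - Int.fract (φ r - φ s) := by
      intro s hs
      obtain ⟨hne, hsR⟩ := Finset.mem_erase.1 hs
      have a1 := hsep r hr s hsR hne.symm ⌊φ r - φ s⌋
      have a2 := hsep s hsR r hr hne ⌊φ s - φ r⌋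
      rw [Int.self_sub_floor, abs_of_nonneg (Int.fract_nonneg _)] at a1 a2
      refine ⟨a1, a2, ?_⟩
      rw [← neg_sub (φ r), Int.fract_neg]
      exact (lt_of_lt_of_le (by positivity) a1).ne'
    have h2 := sum_one_div_fract_le (R.erase r) (fun s => φ r - φ s) hN
      (fun s hs => (hfr s hs).1) (fun s hs u hu hne n => by
        have := hsep u (Finset.mem_of_mem_erase hu) s (Finset.mem_of_mem_erase hs) hne.symm n
        rwa [show φ r - φ s - (φ r - φ u) - n = φ u - φ s - n by ring])
    have h3 := sum_one_div_fract_le (R.erase r) (fun s => φ s - φ r) hN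
      (fun s hs => (hfr s hs).2.1) (fun s hs u hu hne n => by
        have := hsep s (Finset.mem_of_mem_erase hs) u (Finset.mem_of_mem_erase hu) hne n
        rwa [show φ s - φ r - (φ u - φ r) - n = φ s - φ u - n by ring])
    have h4 : ∑ s ∈ R.erase r, D (φ r - φ s) ≤ ∑ s ∈ R.erase r,
        (1 / Int.fract (φ r - φ s) + 1 / Int.fract (φ s - φ r)) / 2 := by
      refine Finset.sum_le_sum fun s hs => ?_
      obtain ⟨a1, -, a3⟩ := hfr s hs
      rw [hD, a3]
      exact norm_sum_unitExp_le M (lt_of_lt_of_le (by positivity) a1)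
    rw [← Finset.sum_div, Finset.sum_add_distrib] at h4
    linarith
  calc ∑ n ∈ Finset.range M, ‖∑ r ∈ R, c r * unitExp (n * φ r)‖ ^ 2
      = ‖∑ r ∈ R, ∑ s ∈ R, c r * starRingEnd ℂ (c s) *
        ∑ n ∈ Finset.range M, unitExp (n * (φ r - φ s))‖ := by
        rw [← hexp, Complex.norm_real, Real.norm_of_nonneg]
        exact Finset.sum_nonneg fun _ _ => by positivity
    _ ≤ ∑ r ∈ R, ∑ s ∈ R, ‖c r‖ * ‖c s‖ * D (φ r - φ s) := by
        refine (norm_sum_le _ _).trans (Finset.sum_le_sum fun r _ =>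
          (norm_sum_le _ _).trans (Finset.sum_le_sum fun s _ => ?_))
        rw [norm_mul, norm_mul, RCLike.norm_conj, hD]
    _ ≤ ∑ r ∈ R, ∑ s ∈ R, (‖c r‖ ^ 2 * D (φ r - φ s) / 2 + ‖c s‖ ^ 2 * D (φ s - φ r) / 2) := by
        refine Finset.sum_le_sum fun r _ => Finset.sum_le_sum fun s _ => ?_
        rw [← hDsymm (φ s - φ r), neg_sub]
        nlinarith [mul_nonneg (sq_nonneg (‖c r‖ - ‖c s‖)) (hD0 (φ r - φ s))]
    _ = ∑ r ∈ R, ‖c r‖ ^ 2 * ∑ s ∈ R, D (φ r - φ s) := by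
        simp_rw [Finset.sum_add_distrib]
        rw [Finset.sum_comm (f := fun r s => ‖c s‖ ^ 2 * D (φ s - φ r) / 2),
          ← Finset.sum_add_distrib]
        refine Finset.sum_congr rfl fun r _ => ?_
        rw [← Finset.sum_add_distrib, Finset.mul_sum]
        exact Finset.sum_congr rfl fun s _ => by ring
    _ ≤ ∑ r ∈ R, ‖c r‖ ^ 2 * (M + N * (1 + Real.log N)) :=
        Finset.sum_le_sum fun r hr => mul_le_mul_of_nonneg_left (hrow r hr) (by positivity)
    _ = (M + N * (1 + Real.log N)) * ∑ r ∈ R, ‖c r‖ ^ 2 := by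
        rw [← Finset.sum_mul, mul_comm]

/-- The exponential sum of the set `A` at frequency `θ`. -/
noncomputable def expSum (A : Finset ℕ) (θ : ℝ) : ℂ :=
  ∑ a ∈ A, unitExp (a * θ)

/-- Nearly uniform nonnegative weights inherit the bias of the unweighted sum. -/
lemma mul_le_norm_sum_mul {L : ℕ} {W : ℕ → ℝ} {z : ℕ → ℂ} {m Z ε : ℝ} (hm : 0 < m)
    (hLm : (L : ℝ) ≤ m) (hZ : 0 ≤ Z) (hz : ∀ j, ‖z j‖ = 1)
    (hW : ∑ j ∈ Finset.range L, W j = Z)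
    (hW2 : ∑ j ∈ Finset.range L, W j ^ 2 ≤ (1 + ε) / m * Z ^ 2) :
    Z * (‖∑ j ∈ Finset.range L, z j‖ / m - Real.sqrt ε) ≤
      ‖∑ j ∈ Finset.range L, (W j : ℂ) * z j‖ := by
  have hsplit : ((Z / m : ℝ) : ℂ) * ∑ j ∈ Finset.range L, z j =
      ∑ j ∈ Finset.range L, (W j : ℂ) * z j -
        ∑ j ∈ Finset.range L, ((W j - Z / m : ℝ) : ℂ) * z j := by
    rw [Finset.mul_sum, ← Finset.sum_sub_distrib]
    refine Finset.sum_congr rfl fun j _ => ?_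
    push_cast
    ring
  have hvar : ∑ j ∈ Finset.range L, (W j - Z / m) ^ 2 ≤ Z ^ 2 * ε / m := by
    have e : ∑ j ∈ Finset.range L, (W j - Z / m) ^ 2 =
        ∑ j ∈ Finset.range L, W j ^ 2 - 2 * (Z / m) * Z + L * (Z / m) ^ 2 := by
      rw [← hW, Finset.mul_sum, ← Finset.sum_sub_distrib]
      simp_rw [sub_sq]
      rw [Finset.sum_add_distrib, Finset.sum_const, Finset.card_range, nsmul_eq_mul]
      congr 1
      exact Finset.sum_congr rfl fun j _ => by ring
    have h1 : L * (Z / m) ^ 2 ≤ m * (Z / m) ^ 2 :=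
      mul_le_mul_of_nonneg_right hLm (sq_nonneg _)
    have h2 : (1 + ε) / m * Z ^ 2 - 2 * (Z / m) * Z + m * (Z / m) ^ 2 = Z ^ 2 * ε / m := by
      field_simp
      ring
    linarith
  have herr : ‖∑ j ∈ Finset.range L, ((W j - Z / m : ℝ) : ℂ) * z j‖ ≤ Z * Real.sqrt ε := by
    have h1 : ‖∑ j ∈ Finset.range L, ((W j - Z / m : ℝ) : ℂ) * z j‖ ≤
        ∑ j ∈ Finset.range L, |W j - Z / m| := by
      refine (norm_sum_le _ _).trans (Finset.sum_le_sum fun j _ => ?_)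
      rw [norm_mul, hz, mul_one, Complex.norm_real, Real.norm_eq_abs]
    have h2 := sq_sum_le_card_mul_sum_sq (s := Finset.range L) (f := fun j => |W j - Z / m|)
    simp_rw [sq_abs] at h2
    rw [Finset.card_range] at h2
    refine h1.trans (Real.le_sqrt_of_sq_le ?_ |>.trans_eq
      (?_ : Real.sqrt (Z ^ 2 * ε) = Z * Real.sqrt ε))
    · refine h2.trans ((mul_le_mul hLm hvar
        (Finset.sum_nonneg fun _ _ => sq_nonneg _) hm.le).trans_eq ?_)
      field_simp
    · rw [Real.sqrt_mul (sq_nonneg Z), Real.sqrt_sq hZ]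
  have h := norm_sub_le (∑ j ∈ Finset.range L, (W j : ℂ) * z j)
    (∑ j ∈ Finset.range L, ((W j - Z / m : ℝ) : ℂ) * z j)
  rw [← hsplit, norm_mul, Complex.norm_real, Real.norm_of_nonneg (by positivity)] at h
  have e : Z * (‖∑ j ∈ Finset.range L, z j‖ / m - Real.sqrt ε) =
      Z / m * ‖∑ j ∈ Finset.range L, z j‖ - Z * Real.sqrt ε := by ring
  rw [e]
  linarith

lemma unitExp_div_eq_of_cast_eq {p : ℕ} (hp : 0 < p) {u v : ℕ} (h : (u : ZMod p) = v) :
    unitExp ((u : ℝ) / p) = unitExp ((v : ℝ) / p) := by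
  have hp' : (p : ℝ) ≠ 0 := by positivity
  have h2 : (((u : ℤ) - v : ℤ) : ZMod p) = 0 := by
    push_cast
    rw [h, sub_self]
  obtain ⟨n, hn⟩ := (ZMod.intCast_zmod_eq_zero_iff_dvd _ _).1 h2
  have h3 : (u : ℝ) - v = p * n := by exact_mod_cast hn
  apply unitExp_eq_of_sub_eq_intCast (n := n)
  rw [← sub_div, h3]
  field_simp

/-- If `A` is nearly uniformly distributed on a progression modulo `p`, its exponential sum at
the multiples of the frequency dual to the common difference is that of an interval. -/
lemma exists_frequency {A : Finset ℕ} {p L : ℕ} (hp : p.Prime) {x d : ZMod p} (hd : d ≠ 0)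
    {m ε : ℝ} (hm : 0 < m) (hLm : (L : ℝ) ≤ m) (hLp : L ≤ p)
    (hA : modImage A p ⊆ (Finset.range L).image (fun j => x + (Nat.cast j : ZMod p) * d))
    (hcoll : (collisions A p : ℝ) ≤ (1 + ε) / m * (A.card : ℝ) ^ 2) :
    ∃ b : ℕ, 0 < b ∧ b < p ∧ ∀ k : ℕ,
      A.card * (‖∑ j ∈ Finset.range L, unitExp (j * (k / p))‖ / m - Real.sqrt ε) ≤
        ‖expSum A (k * (b / p))‖ := by
  have := Fact.mk hp
  have hp0 : (p : ℝ) ≠ 0 := by exact_mod_cast hp.ne_zero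
  obtain ⟨W, hWdef⟩ : ∃ W : ℕ → Finset ℕ, ∀ j, W j =
      A.filter fun a : ℕ => (a : ZMod p) = x + (j : ZMod p) * d := ⟨_, fun _ => rfl⟩
  have hinj : ∀ i ∈ Finset.range L, ∀ j ∈ Finset.range L,
      x + (i : ZMod p) * d = x + (j : ZMod p) * d → i = j := by
    intro i hi j hj hij
    have h1 := mul_right_cancel₀ hd (add_left_cancel hij)
    have h2 := congrArg ZMod.val h1
    rwa [ZMod.val_natCast, ZMod.val_natCast,
      Nat.mod_eq_of_lt ((Finset.mem_range.1 hi).trans_le hLp),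
      Nat.mod_eq_of_lt ((Finset.mem_range.1 hj).trans_le hLp)] at h2
  have hunion : A = (Finset.range L).biUnion W := by
    ext a
    simp only [Finset.mem_biUnion, hWdef, Finset.mem_filter]
    constructor
    · intro ha
      obtain ⟨j, hj, hja⟩ := Finset.mem_image.1 (hA (Finset.mem_image_of_mem _ ha))
      exact ⟨j, hj, ha, hja.symm⟩
    · rintro ⟨j, -, ha, -⟩
      exact ha
  have hdisj : ∀ i ∈ Finset.range L, ∀ j ∈ Finset.range L, i ≠ j → Disjoint (W i) (W j) := by
    intro i hi j hj hij
    rw [Finset.disjoint_left]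
    intro a hai haj
    rw [hWdef, Finset.mem_filter] at hai haj
    exact hij (hinj i hi j hj (hai.2.symm.trans haj.2))
  have hsum : ∑ j ∈ Finset.range L, ((W j).card : ℝ) = A.card := by
    rw [hunion, Finset.card_biUnion hdisj]
    push_cast
    rfl
  have hsq : ∑ j ∈ Finset.range L, ((W j).card : ℝ) ^ 2 ≤
      (1 + ε) / m * (A.card : ℝ) ^ 2 := by
    refine le_trans (le_of_eq ?_) hcoll
    have h1 : collisions A p = ((Finset.range L).biUnion fun j => W j ×ˢ W j).card := by
      unfold collisions
      congr 1
      ext ⟨a, b⟩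
      simp only [Finset.mem_filter, Finset.mem_product, Finset.mem_biUnion, hWdef]
      constructor
      · rintro ⟨⟨ha, hb⟩, hab⟩
        obtain ⟨j, hj, hja⟩ := Finset.mem_image.1 (hA (Finset.mem_image_of_mem _ ha))
        exact ⟨j, hj, ⟨ha, hja.symm⟩, hb, hab ▸ hja.symm⟩
      · rintro ⟨j, -, ⟨ha, haj⟩, hb, hbj⟩
        exact ⟨⟨ha, hb⟩, haj.trans hbj.symm⟩
    rw [h1, Finset.card_biUnion fun i hi j hj hij =>
      Finset.disjoint_product.2 (Or.inl (hdisj i hi j hj hij))]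
    push_cast
    exact Finset.sum_congr rfl fun j _ => by rw [Finset.card_product]; push_cast; ring
  have hb0 : d⁻¹ ≠ 0 := inv_ne_zero hd
  refine ⟨d⁻¹.val, Nat.pos_of_ne_zero fun h => hb0 ((ZMod.val_eq_zero _).1 h),
    ZMod.val_lt _, fun k => ?_⟩
  have hmain := mul_le_norm_sum_mul (z := fun j => unitExp (j * (k / p))) hm hLm
    (Nat.cast_nonneg A.card) (fun j => norm_unitExp _) hsum hsq
  refine hmain.trans_eq ?_
  have hphase : expSum A (k * (d⁻¹.val / p)) =
      unitExp (((k * (x * d⁻¹).val : ℕ) : ℝ) / p) *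
        ∑ j ∈ Finset.range L, (((W j).card : ℝ) : ℂ) * unitExp (j * (k / p)) := by
    unfold expSum
    conv_lhs => rw [hunion]
    rw [Finset.sum_biUnion hdisj, Finset.mul_sum]
    refine Finset.sum_congr rfl fun j _ => ?_
    have hconst : ∀ a ∈ W j, unitExp (a * (k * (d⁻¹.val / p))) =
        unitExp (((k * (x * d⁻¹).val : ℕ) : ℝ) / p) * unitExp (j * (k / p)) := by
      intro a ha
      rw [hWdef, Finset.mem_filter] at ha
      have h1 : ((a * (k * d⁻¹.val) : ℕ) : ZMod p) =
          ((k * (x * d⁻¹).val + j * k : ℕ) : ZMod p) := by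
        push_cast
        rw [ZMod.natCast_zmod_val, ZMod.natCast_zmod_val, ha.2]
        field_simp
      have h2 := unitExp_div_eq_of_cast_eq hp.pos h1
      rw [← unitExp_add]
      convert h2 using 2
      · push_cast
        ring
      · push_cast
        ring
    rw [Finset.sum_congr rfl hconst, Finset.sum_const, nsmul_eq_mul]
    push_cast
    ring
  rw [hphase, norm_mul, norm_unitExp, one_mul]

lemma le_norm_sum_unitExp_div {p k L : ℕ} (hp : 0 < p) (hk : 0 < k) {δ : ℝ} (n : ℤ)
    (hδ : 0 ≤ δ) (h1 : (n + δ) * p ≤ k * L) (h2 : (k * L : ℝ) ≤ (n + 1 - δ) * p) :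
    2 * δ * p / (Real.pi * k) ≤ ‖∑ j ∈ Finset.range L, unitExp (j * (k / p))‖ := by
  have hπ := Real.pi_pos
  have hp' : (0 : ℝ) < p := by exact_mod_cast hp
  have hk' : (0 : ℝ) < k := by exact_mod_cast hk
  have e := norm_sum_unitExp_mul L ((k : ℝ) / p)
  have hlow := four_mul_le_norm_unitExp_sub_one (x := L * ((k : ℝ) / p)) n hδ
    (by rw [mul_div_assoc', le_div_iff₀ hp']; linarith)
    (by rw [mul_div_assoc', div_le_iff₀ hp']; linarith)
  have hup := norm_unitExp_sub_one_le ((k : ℝ) / p)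
  rw [abs_of_nonneg (by positivity)] at hup
  have h3 := mul_le_mul_of_nonneg_left hup
    (norm_nonneg (∑ j ∈ Finset.range L, unitExp (j * ((k : ℝ) / p))))
  rw [e] at h3
  have h4 := hlow.trans h3
  rw [div_le_iff₀ (by positivity)]
  rw [mul_div_assoc', mul_div_assoc', le_div_iff₀ hp'] at h4
  linarith

/-- The frequency produced by a nearly extremal prime, with the numerical bounds used below. -/
lemma exists_biased_frequency {A : Finset ℕ} {p : ℕ} {α : ℝ} (hp : p.Prime) (hα1 : 1 / 3 ≤ α)
    (hα2 : α ≤ 1 / 2) (hZ : 0 < A.card) (hA : InAP (modImage A p) (α * p))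
    (hcoll : (collisions A p : ℝ) ≤ (1 + 1 / 40000) / (α * p) * (A.card : ℝ) ^ 2) :
    ∃ b : ℕ, 0 < b ∧ b < p ∧ ∀ (k : ℕ) (n : ℤ), 0 < k → k * α ≤ 2 →
      (n + 1 / 20 : ℝ) ≤ k * α → k * α ≤ n + 24 / 25 →
      1 / 200 * (A.card : ℝ) ≤ ‖expSum A (k * (b / p))‖ := by
  obtain ⟨L, x, d, hd, hL, hsub⟩ := hA
  have hp' : (0 : ℝ) < p := by exact_mod_cast hp.pos
  have hZ' : (0 : ℝ) < A.card := by exact_mod_cast hZ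
  have hm : 0 < α * p := by positivity
  have hLp : L ≤ p := by
    have : (L : ℝ) ≤ p := by nlinarith
    exact_mod_cast this
  have hLlow : α * p ≤ (1 + 1 / 40000) * L := by
    have h1 := sq_card_le_mul_collisions A p
    have h2 : ((modImage A p).card : ℝ) ≤ L := by
      have := (Finset.card_le_card hsub).trans Finset.card_image_le
      rw [Finset.card_range] at this
      exact_mod_cast this
    have h3 := h1.trans (mul_le_mul h2 hcoll (by positivity) (by positivity))
    have h4 : L * ((1 + 1 / 40000) / (α * p) * (A.card : ℝ) ^ 2) =
        ((1 + 1 / 40000) * L / (α * p)) * (A.card : ℝ) ^ 2 := by ring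
    rw [h4] at h3
    have h5 : 1 ≤ (1 + 1 / 40000) * L / (α * p) := by
      by_contra h
      push Not at h
      nlinarith [sq_pos_of_pos hZ']
    rwa [one_le_div hm] at h5
  obtain ⟨b, hb0, hbp, hb⟩ := exists_frequency hp hd hm hL hLp hsub hcoll
  refine ⟨b, hb0, hbp, fun k n hk hk2 hn1 hn2 => le_trans ?_ (hb k)⟩
  have hk' : (0 : ℝ) < k := by exact_mod_cast hk
  have hsum := le_norm_sum_unitExp_div (L := L) hp.pos hk (δ := 1 / 25) n (by norm_num)
    (by
      have h1 : k * (α * p) ≤ k * ((1 + 1 / 40000) * L) :=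
        mul_le_mul_of_nonneg_left hLlow hk'.le
      have h2 : (n + 1 / 20 : ℝ) * p ≤ k * α * p := mul_le_mul_of_nonneg_right hn1 hp'.le
      have h3 : k * (α * p) ≤ 2 * p := by nlinarith
      nlinarith)
    (by
      have h1 : (k : ℝ) * L ≤ k * (α * p) := mul_le_mul_of_nonneg_left hL hk'.le
      have h2 : k * α * p ≤ (n + 24 / 25 : ℝ) * p := mul_le_mul_of_nonneg_right hn2 hp'.le
      linarith)
  have hε : Real.sqrt (1 / 40000) = 1 / 200 := by
    rw [show (1 / 40000 : ℝ) = (1 / 200) ^ 2 by norm_num, Real.sqrt_sq (by norm_num)]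
  rw [hε, mul_comm]
  apply mul_le_mul_of_nonneg_left _ hZ'.le
  have hfinal : 1 / 100 ≤ ‖∑ j ∈ Finset.range L, unitExp (j * ((k : ℝ) / p))‖ / (α * p) := by
    rw [le_div_iff₀ hm]
    refine le_trans ?_ hsum
    rw [le_div_iff₀ (by positivity)]
    have hπ := Real.pi_lt_d2
    have : Real.pi * (k * α) ≤ 3.15 * 2 :=
      mul_le_mul hπ.le hk2 (by positivity) (by norm_num)
    nlinarith
  linarith

/-- A prime occurring in only one of the denominators `p, p', q, q'`, or twice with the same
sign, cannot cancel. -/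
lemma div_sub_div_sub_ne_intCast {p p' q q' : ℕ} {b : ℕ → ℕ} (hp : p.Prime) (hp' : p'.Prime)
    (hq : q.Prime) (hq' : q'.Prime) (h2 : 2 < p) (hb0 : 0 < b p) (hbp : b p < p)
    (hpp' : p ≠ p') (hpq : p ≠ q) (n : ℤ) :
    (b p / p - b p' / p' - (b q / q - b q' / q') : ℝ) ≠ n := by
  intro h
  have hR : ∀ {r : ℕ}, r.Prime → (r : ℝ) ≠ 0 := fun hr => by exact_mod_cast hr.ne_zero
  have np : (p : ℝ) ≠ 0 := hR hp
  have np' : (p' : ℝ) ≠ 0 := hR hp'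
  have nq : (q : ℝ) ≠ 0 := hR hq
  have nq' : (q' : ℝ) ≠ 0 := hR hq'
  have hpZ : Prime (p : ℤ) := Nat.prime_iff_prime_int.1 hp
  have hndvd : ∀ {r : ℕ}, r.Prime → p ≠ r → ¬ (p : ℤ) ∣ r := fun hr hne hd =>
    hne ((Nat.prime_dvd_prime_iff_eq hp hr).1 (by exact_mod_cast hd))
  have hnb : ¬ (p : ℤ) ∣ b p := fun hd =>
    absurd (Nat.le_of_dvd hb0 (by exact_mod_cast hd)) (not_le.2 hbp)
  by_cases hpq' : p = q'
  · subst hpq'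
    have e : (2 * b p * p' * q : ℝ) = p * (n * p' * q + b p' * q + b q * p') := by
      field_simp at h
      linear_combination h
    have eZ : (2 * b p * p' * q : ℤ) = p * (n * p' * q + b p' * q + b q * p') := by
      exact_mod_cast e
    have hdvd : (p : ℤ) ∣ 2 * b p * p' * q := ⟨_, eZ⟩
    rcases hpZ.dvd_or_dvd hdvd with hd | hd
    · rcases hpZ.dvd_or_dvd hd with hd | hd
      · rcases hpZ.dvd_or_dvd hd with hd | hd
        · exact absurd (Int.le_of_dvd (by norm_num) hd) (by omega)
        · exact hnb hd
      · exact hndvd hp' hpp' hd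
    · exact hndvd hq hpq hd
  · have e : (b p * p' * q * q' : ℝ) =
        p * (n * p' * q * q' + b p' * q * q' + b q * p' * q' - b q' * p' * q) := by
      field_simp at h
      linarith
    have eZ : (b p * p' * q * q' : ℤ) =
        p * (n * p' * q * q' + b p' * q * q' + b q * p' * q' - b q' * p' * q) := by
      exact_mod_cast e
    have hdvd : (p : ℤ) ∣ b p * p' * q * q' := ⟨_, eZ⟩
    rcases hpZ.dvd_or_dvd hdvd with hd | hd
    · rcases hpZ.dvd_or_dvd hd with hd | hd
      · rcases hpZ.dvd_or_dvd hd with hd | hd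
        · exact hnb hd
        · exact hndvd hp' hpp' hd
      · exact hndvd hq hpq hd
    · exact hndvd hq' hpq' hd

lemma one_div_le_abs_of_ne {p p' q q' N : ℕ} {a b c d n : ℤ} (hp : 0 < p) (hp' : 0 < p')
    (hq : 0 < q) (hq' : 0 < q') (hN : p * p' * (q * q') ≤ N)
    (hne : (a / p - b / p' - (c / q - d / q') : ℝ) ≠ n) :
    1 / (N : ℝ) ≤ |(a / p - b / p' - (c / q - d / q') - n : ℝ)| := by
  have hP : (0 : ℝ) < p * p' * (q * q') := by positivity
  have hNR : (p * p' * (q * q') : ℝ) ≤ N := by exact_mod_cast hN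
  have e : (a / p - b / p' - (c / q - d / q') - n : ℝ) * (p * p' * (q * q')) =
      ((a * p' * q * q' - b * p * q * q' - c * p * p' * q' + d * p * p' * q -
        n * p * p' * q * q' : ℤ) : ℝ) := by
    have h1 : (p : ℝ) ≠ 0 := by positivity
    have h2 : (p' : ℝ) ≠ 0 := by positivity
    have h3 : (q : ℝ) ≠ 0 := by positivity
    have h4 : (q' : ℝ) ≠ 0 := by positivity
    push_cast
    field_simp
    ring
  have hne' : (a / p - b / p' - (c / q - d / q') - n : ℝ) ≠ 0 := sub_ne_zero.2 hne
  have hz := mul_ne_zero hne' hP.ne'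
  rw [e] at hz
  have h1 := Int.one_le_abs (Int.cast_ne_zero.1 hz)
  have h2 : (1 : ℝ) ≤ |(((a * p' * q * q' - b * p * q * q' - c * p * p' * q' + d * p * p' * q -
        n * p * p' * q * q' : ℤ) : ℤ) : ℝ)| := by
    rw [← Int.cast_abs]
    exact_mod_cast h1
  rw [← e, abs_mul, abs_of_pos hP] at h2
  calc 1 / (N : ℝ) ≤ 1 / (p * p' * (q * q')) := one_div_le_one_div_of_le hP hNR
    _ ≤ _ := by rwa [div_le_iff₀ hP]

/-- Differences of two fractions with distinct prime denominators at most `N ^ (1 / 4)` are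
`1 / N`-separated modulo one. -/
lemma separated_differences {P : Finset ℕ} {N : ℕ} {b : ℕ → ℕ}
    (hP : ∀ p ∈ P, p.Prime ∧ 2 < p ∧ p ^ 4 ≤ N ∧ 0 < b p ∧ b p < p) :
    ∀ r ∈ P.offDiag, ∀ s ∈ P.offDiag, r ≠ s → ∀ n : ℤ, 1 / (N : ℝ) ≤
      |(b r.1 / r.1 - b r.2 / r.2 : ℝ) - (b s.1 / s.1 - b s.2 / s.2 : ℝ) - n| := by
  rintro ⟨p, p'⟩ hr ⟨q, q'⟩ hs hne n
  obtain ⟨hp, hp', hpp'⟩ := Finset.mem_offDiag.1 hr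
  obtain ⟨hq, hq', hqq'⟩ := Finset.mem_offDiag.1 hs
  simp only at hp hp' hpp' hq hq' hqq' ⊢
  obtain ⟨a1, a2, a3, a4, a5⟩ := hP p hp
  obtain ⟨b1, b2, b3, b4, b5⟩ := hP p' hp'
  obtain ⟨c1, c2, c3, c4, c5⟩ := hP q hq
  obtain ⟨d1, d2, d3, d4, d5⟩ := hP q' hq'
  have hprod : p * p' * (q * q') ≤ N := by
    obtain ⟨m, hm⟩ : ∃ m, m = max (max p p') (max q q') := ⟨_, rfl⟩
    have hmN : m ^ 4 ≤ N := by
      rw [hm]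
      rcases max_choice (max p p') (max q q') with h | h <;> rw [h]
      · rcases max_choice p p' with h | h <;> rw [h] <;> assumption
      · rcases max_choice q q' with h | h <;> rw [h] <;> assumption
    have e1 : p ≤ m := by omega
    have e2 : p' ≤ m := by omega
    have e3 : q ≤ m := by omega
    have e4 : q' ≤ m := by omega
    calc p * p' * (q * q') ≤ m * m * (m * m) := by gcongr
      _ = m ^ 4 := by ring
      _ ≤ N := hmN
  have hX : (b p / p - b p' / p' - (b q / q - b q' / q') : ℝ) ≠ n := by
    by_cases hpq : p = q
    · have hpq' : p' ≠ q' := fun h => hne (by rw [hpq, h])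
      have h := div_sub_div_sub_ne_intCast (b := b) b1 a1 d1 c1 b2 b4 b5 hpp'.symm hpq' (-n)
      intro h'
      apply h
      push_cast
      linarith
    · exact div_sub_div_sub_ne_intCast a1 b1 c1 d1 a2 a4 a5 hpp' hpq n
  have h := one_div_le_abs_of_ne (a := b p) (b := b p') (c := b q) (d := b q') (n := n)
    a1.pos b1.pos c1.pos d1.pos hprod (by simpa only [Int.cast_natCast] using hX)
  simpa only [Int.cast_natCast] using h

lemma fourth_moment_le {P : Finset ℕ} {θ : ℕ → ℝ} {u : ℕ → ℂ} {N : ℕ} (hN : 0 < N)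
    (hu : ∀ p, ‖u p‖ = 1)
    (hsep : ∀ r ∈ P.offDiag, ∀ s ∈ P.offDiag, r ≠ s → ∀ n : ℤ,
      1 / (N : ℝ) ≤ |(θ r.1 - θ r.2) - (θ s.1 - θ s.2) - n|) (M : ℕ) :
    ∑ n ∈ Finset.range M, ‖∑ p ∈ P, u p * unitExp (n * θ p)‖ ^ 4 ≤
      (4 * M + 2 * N * (1 + Real.log N)) * (P.card : ℝ) ^ 2 := by
  obtain ⟨E, hE⟩ : ∃ E : ℕ → ℂ, ∀ n, E n = ∑ r ∈ P.offDiag,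
    (u r.1 * starRingEnd ℂ (u r.2)) * unitExp (n * (θ r.1 - θ r.2)) := ⟨_, fun _ => rfl⟩
  have hsq : ∀ n : ℕ, ((‖∑ p ∈ P, u p * unitExp (n * θ p)‖ ^ 2 : ℝ) : ℂ) = P.card + E n := by
    intro n
    push_cast
    rw [← Complex.mul_conj', map_sum, Finset.sum_mul_sum, ← Finset.sum_product',
      ← Finset.diag_union_offDiag, Finset.sum_union (Finset.disjoint_diag_offDiag P), hE]
    congr 1
    · rw [Finset.sum_diag, Finset.card_eq_sum_ones, Nat.cast_sum]
      refine Finset.sum_congr rfl fun p _ => ?_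
      rw [Complex.mul_conj', norm_mul, hu, norm_unitExp]
      norm_num
    · refine Finset.sum_congr rfl fun r _ => ?_
      rw [map_mul, star_unitExp, mul_sub, sub_eq_add_neg, unitExp_add]
      ring
  have hpt : ∀ n : ℕ, ‖∑ p ∈ P, u p * unitExp (n * θ p)‖ ^ 4 ≤
      2 * (P.card : ℝ) ^ 2 + 2 * ‖E n‖ ^ 2 := by
    intro n
    have h1 : ‖∑ p ∈ P, u p * unitExp (n * θ p)‖ ^ 2 ≤ P.card + ‖E n‖ := by
      have h := congrArg norm (hsq n)
      rw [Complex.norm_real, Real.norm_of_nonneg (by positivity)] at h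
      rw [h]
      refine (norm_add_le _ _).trans ?_
      rw [Complex.norm_natCast]
    have h2 : ‖∑ p ∈ P, u p * unitExp (n * θ p)‖ ^ 4 =
        (‖∑ p ∈ P, u p * unitExp (n * θ p)‖ ^ 2) ^ 2 := by ring
    rw [h2]
    have h3 := pow_le_pow_left₀ (by positivity) h1 2
    nlinarith [sq_nonneg ((P.card : ℝ) - ‖E n‖)]
  have hls := dual_large_sieve P.offDiag (fun r => θ r.1 - θ r.2)
    (fun r => u r.1 * starRingEnd ℂ (u r.2)) hN hsep M
  simp_rw [← hE, norm_mul, RCLike.norm_conj, hu] at hls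
  rw [Finset.sum_const, nsmul_eq_mul] at hls
  have hcard : (P.offDiag.card : ℝ) ≤ (P.card : ℝ) ^ 2 := by
    rw [Finset.offDiag_card]
    have : P.card * P.card - P.card ≤ P.card ^ 2 := by rw [sq]; exact Nat.sub_le _ _
    exact_mod_cast this
  have hsum := Finset.sum_le_sum fun n (_ : n ∈ Finset.range M) => hpt n
  rw [Finset.sum_add_distrib, Finset.sum_const, Finset.card_range, nsmul_eq_mul,
    ← Finset.mul_sum] at hsum
  have hlog := Real.log_natCast_nonneg N
  have hls2 : ∑ n ∈ Finset.range M, ‖E n‖ ^ 2 ≤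
      (M + N * (1 + Real.log N)) * (P.card : ℝ) ^ 2 := by
    refine hls.trans (mul_le_mul_of_nonneg_left ?_ (by positivity))
    rwa [one_mul, one_pow, mul_one]
  nlinarith

/-- Bias at both `θ p` and `k * θ p` for many primes `p` forces some dilate difference
`k * a - b` to have many representations. -/
lemma biased_frequencies_bound {A P : Finset ℕ} {N k : ℕ} {b : ℕ → ℕ} {κ T : ℝ}
    (hA : A ⊆ Finset.Icc 1 N) (hκ : 0 < κ) (hT : ∀ y : ℤ, ((fibre A k y).card : ℝ) ≤ T)
    (hN : 0 < N) (hAcard : 0 < A.card) (hPcard : 0 < P.card)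
    (hP : ∀ p ∈ P, p.Prime ∧ 2 < p ∧ p ^ 4 ≤ N ∧ 0 < b p ∧ b p < p)
    (h1 : ∀ p ∈ P, κ * A.card ≤ ‖expSum A (b p / p)‖)
    (h2 : ∀ p ∈ P, κ * A.card ≤ ‖expSum A (k * (b p / p))‖) :
    κ ^ 8 * (A.card : ℝ) ^ 2 * (P.card : ℝ) ^ 2 ≤
      T * (N * (4 * k + 6 + 2 * Real.log N)) := by
  obtain ⟨Z, hZ⟩ : ∃ Z : ℝ, Z = A.card := ⟨_, rfl⟩
  obtain ⟨g, hg⟩ : ∃ g : ℝ, g = P.card := ⟨_, rfl⟩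
  have hZ0 : 0 < Z := by rw [hZ]; exact_mod_cast hAcard
  have hg0 : 0 < g := by rw [hg]; exact_mod_cast hPcard
  obtain ⟨θ, hθ⟩ : ∃ θ : ℕ → ℝ, ∀ p, θ p = b p / p := ⟨_, fun _ => rfl⟩
  obtain ⟨w, hw⟩ : ∃ w : ℕ → ℂ, ∀ p, w p = unitExp (N * θ p) *
    (expSum A (k * θ p) * starRingEnd ℂ (expSum A (θ p))) := ⟨_, fun _ => rfl⟩
  have hphase : ∀ p, ∃ u : ℂ, ‖u‖ = 1 ∧ ((‖w p‖ : ℝ) : ℂ) = u * w p := fun p =>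
    RCLike.exists_norm_eq_mul_self (w p)
  choose u hu1 hu2 using hphase
  obtain ⟨G, hG⟩ : ∃ G : ℕ → ℂ, ∀ n, G n = ∑ p ∈ P, u p * unitExp (n * θ p) :=
    ⟨_, fun _ => rfl⟩
  obtain ⟨f, hf⟩ : ∃ f : ℕ × ℕ → ℕ, ∀ x, f x = k * x.1 + N - x.2 := ⟨_, fun _ => rfl⟩
  obtain ⟨M, hM⟩ : ∃ M, M = (k + 1) * N := ⟨_, rfl⟩
  obtain ⟨r, hr⟩ : ∃ r : ℕ → ℝ, ∀ n, r n = (((A ×ˢ A).filter fun x => f x = n).card : ℝ) :=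
    ⟨_, fun _ => rfl⟩
  have hbd : ∀ x ∈ A ×ˢ A, 1 ≤ x.1 ∧ x.1 ≤ N ∧ 1 ≤ x.2 ∧ x.2 ≤ N := by
    intro x hx
    obtain ⟨hx1, hx2⟩ := Finset.mem_product.1 hx
    have a1 := Finset.mem_Icc.1 (hA hx1)
    have a2 := Finset.mem_Icc.1 (hA hx2)
    exact ⟨a1.1, a1.2, a2.1, a2.2⟩
  have hmaps : ∀ x ∈ A ×ˢ A, f x ∈ Finset.range M := by
    intro x hx
    obtain ⟨a1, a2, a3, a4⟩ := hbd x hx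
    have := Nat.mul_le_mul_left k a2
    rw [Finset.mem_range, hf, hM, add_mul, one_mul]
    omega
  have hsumG : ((∑ p ∈ P, ‖w p‖ : ℝ) : ℂ) = ∑ x ∈ A ×ˢ A, G (f x) := by
    push_cast
    simp_rw [hG]
    rw [Finset.sum_comm]
    refine Finset.sum_congr rfl fun p _ => ?_
    rw [hu2, hw]
    unfold expSum
    rw [map_sum, Finset.sum_mul_sum, ← Finset.sum_product', Finset.mul_sum, Finset.mul_sum]
    refine Finset.sum_congr rfl fun x hx => ?_
    obtain ⟨a1, a2, a3, a4⟩ := hbd x hx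
    rw [star_unitExp, ← unitExp_add, ← unitExp_add, hf, Nat.cast_sub (by omega)]
    congr 2
    push_cast
    ring
  have hlow : κ ^ 2 * Z ^ 2 * g ≤ ∑ p ∈ P, ‖w p‖ := by
    rw [hg, mul_comm, ← nsmul_eq_mul]
    refine Finset.card_nsmul_le_sum _ _ _ fun p hp => ?_
    have e1 := h1 p hp
    have e2 := h2 p hp
    rw [← hZ, ← hθ] at e1 e2
    rw [hw, norm_mul, norm_unitExp, one_mul, norm_mul, RCLike.norm_conj]
    calc κ ^ 2 * Z ^ 2 = (κ * Z) * (κ * Z) := by ring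
      _ ≤ _ := mul_le_mul e2 e1 (by positivity) (by positivity)
  have hup : (∑ p ∈ P, ‖w p‖) ^ 2 ≤ Z ^ 2 * ∑ x ∈ A ×ˢ A, ‖G (f x)‖ ^ 2 := by
    have e1 : ∑ p ∈ P, ‖w p‖ ≤ ∑ x ∈ A ×ˢ A, ‖G (f x)‖ := by
      have := congrArg norm hsumG
      rw [Complex.norm_real, Real.norm_of_nonneg
        (Finset.sum_nonneg fun _ _ => norm_nonneg _)] at this
      rw [this]
      exact norm_sum_le _ _
    refine (pow_le_pow_left₀ (Finset.sum_nonneg fun _ _ => norm_nonneg _) e1 2).trans ?_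
    refine sq_sum_le_card_mul_sum_sq.trans (le_of_eq ?_)
    rw [Finset.card_product, hZ]
    push_cast
    ring
  have hfib : ∀ F : ℕ → ℝ, ∑ x ∈ A ×ˢ A, F (f x) = ∑ n ∈ Finset.range M, r n * F n := by
    intro F
    rw [← Finset.sum_fiberwise_of_maps_to hmaps]
    refine Finset.sum_congr rfl fun n _ => ?_
    rw [hr, ← nsmul_eq_mul, ← Finset.sum_const]
    exact Finset.sum_congr rfl fun x hx => by rw [(Finset.mem_filter.1 hx).2]
  have hrT : ∀ n, r n ≤ T := by
    intro n
    refine le_trans ?_ (hT (n - N))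
    rw [hr]
    have : ((A ×ˢ A).filter fun x => f x = n).card ≤ (fibre A k (n - N)).card := by
      apply Finset.card_le_card_of_injOn (fun x => x.1)
      · intro x hx
        obtain ⟨hx1, hx2⟩ := Finset.mem_filter.1 hx
        obtain ⟨a1, a2, a3, a4⟩ := hbd x hx1
        rw [hf] at hx2
        refine Finset.mem_filter.2 ⟨(Finset.mem_product.1 hx1).1, x.2,
          (Finset.mem_product.1 hx1).2, ?_⟩
        rw [← hx2, Nat.cast_sub (by omega)]
        push_cast
        ring
      · intro x hx y hy hxy
        obtain ⟨hx1, hx2⟩ := Finset.mem_filter.1 hx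
        obtain ⟨hy1, hy2⟩ := Finset.mem_filter.1 hy
        obtain ⟨a1, a2, a3, a4⟩ := hbd x hx1
        obtain ⟨c1, c2, c3, c4⟩ := hbd y hy1
        simp only at hxy
        rw [hf] at hx2 hy2
        rw [← hxy] at hy2
        exact Prod.ext hxy (by omega)
    exact_mod_cast this
  have hr0 : ∀ n, 0 ≤ r n := fun n => by rw [hr]; positivity
  have hr2 : ∑ n ∈ Finset.range M, r n ^ 2 ≤ T * Z ^ 2 := by
    have e := hfib fun _ => 1
    rw [Finset.sum_const, nsmul_eq_mul, Finset.card_product] at e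
    push_cast at e
    rw [← hZ] at e
    have e2 : Z ^ 2 = ∑ n ∈ Finset.range M, r n := by
      rw [sq, ← mul_one (Z * Z), e]
      exact Finset.sum_congr rfl fun n _ => mul_one _
    rw [e2, Finset.mul_sum]
    refine Finset.sum_le_sum fun n _ => ?_
    rw [sq]
    exact mul_le_mul_of_nonneg_right (hrT n) (hr0 n)
  have hcs : (∑ x ∈ A ×ˢ A, ‖G (f x)‖ ^ 2) ^ 2 ≤
      (T * Z ^ 2) * ∑ n ∈ Finset.range M, ‖G n‖ ^ 4 := by
    rw [hfib fun n => ‖G n‖ ^ 2]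
    refine (Finset.sum_mul_sq_le_sq_mul_sq _ _ _).trans ?_
    simp_rw [← pow_mul]
    exact mul_le_mul_of_nonneg_right hr2 (Finset.sum_nonneg fun _ _ => by positivity)
  have hT0 : 0 ≤ T := (hr0 0).trans (hrT 0)
  have hsep := separated_differences hP
  simp_rw [← hθ] at hsep
  have hfour := fourth_moment_le hN hu1 hsep M
  simp_rw [← hG] at hfour
  rw [← hg] at hfour
  have hMR : (M : ℝ) = (k + 1) * N := by rw [hM]; push_cast; ring
  have hchain : (κ ^ 2 * Z ^ 2 * g) ^ 4 ≤ Z ^ 4 * ((T * Z ^ 2) *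
      ((4 * M + 2 * N * (1 + Real.log N)) * g ^ 2)) := by
    calc (κ ^ 2 * Z ^ 2 * g) ^ 4 ≤ (∑ p ∈ P, ‖w p‖) ^ 4 :=
          pow_le_pow_left₀ (by positivity) hlow 4
      _ = ((∑ p ∈ P, ‖w p‖) ^ 2) ^ 2 := by ring
      _ ≤ (Z ^ 2 * ∑ x ∈ A ×ˢ A, ‖G (f x)‖ ^ 2) ^ 2 :=
          pow_le_pow_left₀ (by positivity) hup 2
      _ = Z ^ 4 * (∑ x ∈ A ×ˢ A, ‖G (f x)‖ ^ 2) ^ 2 := by ring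
      _ ≤ _ := by
          apply mul_le_mul_of_nonneg_left _ (by positivity)
          exact hcs.trans (mul_le_mul_of_nonneg_left hfour (by positivity))
  rw [hMR] at hchain
  rw [← hZ, ← hg]
  refine le_of_mul_le_mul_left ?_ (show 0 < Z ^ 6 * g ^ 2 by positivity)
  calc Z ^ 6 * g ^ 2 * (κ ^ 8 * Z ^ 2 * g ^ 2) = (κ ^ 2 * Z ^ 2 * g) ^ 4 := by ring
    _ ≤ _ := hchain
    _ = _ := by ring

lemma rpow_eq_exp_mul_log {N : ℕ} (hN : 0 < N) (s : ℝ) :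
    (N : ℝ) ^ s = Real.exp (s * Real.log N) := by
  rw [Real.rpow_def_of_pos (by exact_mod_cast hN), mul_comm]

lemma InAP.card_le {p : ℕ} {S : Finset (ZMod p)} {t : ℝ} (h : InAP S t) : (S.card : ℝ) ≤ t := by
  obtain ⟨L, x, d, -, hL, hS⟩ := h
  have := (Finset.card_le_card hS).trans Finset.card_image_le
  rw [Finset.card_range] at this
  exact le_trans (by exact_mod_cast this) hL

/-- If `A` is nearly as large as the larger sieve permits, then the primes modulo which `A` is
far from uniform on its progression are sparse. -/
lemma sum_log_div_bad_primes_le {K : ℝ}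
    (hK : ∀ x : ℝ, 1 ≤ x →
      Real.log x - K ≤ ∑ p ∈ primesUpTo x, Real.log p / p ∧
      ∑ p ∈ primesUpTo x, Real.log p / p ≤ Real.log x + K ∧
      ∑ p ∈ primesUpTo x, Real.log p / (p : ℝ) ^ 2 ≤ K)
    {A : Finset ℕ} {N : ℕ} {α Q ε : ℝ} (hA : A ⊆ Finset.Icc 1 N) (hα0 : 0 < α) (hQ : 1 ≤ Q)
    (hZ : Q ≤ A.card)
    (hmod : ∀ p ∈ primesUpTo Q, ((modImage A p).card : ℝ) ≤ α * p)
    {B : Finset ℕ} (hB : B ⊆ primesUpTo Q)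
    (hbad : ∀ p ∈ B, (1 + ε) / (α * p) * (A.card : ℝ) ^ 2 ≤ collisions A p) :
    ε * ∑ p ∈ B, Real.log p / p ≤ α * (Real.log N + Real.log 4) - Real.log Q + K := by
  obtain ⟨hK1, -, -⟩ := hK Q hQ
  have hs := larger_sieve hA (primesUpTo Q) fun p hp => (mem_primesUpTo.1 hp).1
  have hθ := sum_log_primesUpTo_le (x := Q) (by linarith)
  obtain ⟨Z, hZdef⟩ : ∃ Z : ℝ, Z = A.card := ⟨_, rfl⟩
  rw [← hZdef] at hZ hs
  have hZ0 : 0 < Z := by linarith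
  have hp0 : ∀ p ∈ primesUpTo Q, (0 : ℝ) < p := fun p hp => by
    exact_mod_cast (mem_primesUpTo.1 hp).1.pos
  have hlow : ∀ p ∈ primesUpTo Q, Z ^ 2 / α * (Real.log p / p) ≤
      Real.log p * collisions A p := by
    intro p hp
    have h0 := hp0 p hp
    have h1 := (sq_card_le_mul_collisions A p).trans
      (mul_le_mul_of_nonneg_right (hmod p hp) (Nat.cast_nonneg _))
    rw [← hZdef] at h1
    have h2 : Z ^ 2 / (α * p) ≤ collisions A p := by
      rw [div_le_iff₀ (by positivity)]
      linarith
    refine le_trans (le_of_eq ?_)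
      (mul_le_mul_of_nonneg_left h2 (Real.log_natCast_nonneg p))
    field_simp
  have hlowB : ∀ p ∈ B, Z ^ 2 / α * (1 + ε) * (Real.log p / p) ≤
      Real.log p * collisions A p := by
    intro p hp
    have h0 := hp0 p (hB hp)
    have h1 := hbad p hp
    rw [← hZdef] at h1
    refine le_trans (le_of_eq ?_)
      (mul_le_mul_of_nonneg_left h1 (Real.log_natCast_nonneg p))
    field_simp
  have hB1 := Finset.sum_le_sum hlowB
  have hB2 := Finset.sum_le_sum fun p (hp : p ∈ primesUpTo Q \ B) =>
    hlow p (Finset.mem_sdiff.1 hp).1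
  have hB3 := Finset.sum_sdiff hB (f := fun p : ℕ => Real.log p * (collisions A p : ℝ))
  have hB4 := Finset.sum_sdiff hB (f := fun p : ℕ => Real.log p / p)
  rw [← Finset.mul_sum] at hB1 hB2
  simp_rw [mul_sub] at hs
  rw [Finset.sum_sub_distrib, ← Finset.sum_mul] at hs
  have hθZ : (∑ p ∈ primesUpTo Q, Real.log p) * Z ≤ Real.log 4 * Z ^ 2 := by
    have hl4 : 0 < Real.log 4 := Real.log_pos (by norm_num)
    have := mul_le_mul_of_nonneg_right (hθ.trans (mul_le_mul_of_nonneg_left hZ hl4.le)) hZ0.le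
    linarith
  obtain ⟨σ, hσ⟩ : ∃ σ : ℝ, σ = ∑ p ∈ B, Real.log p / p := ⟨_, rfl⟩
  obtain ⟨τ, hτ⟩ : ∃ τ : ℝ, τ = ∑ p ∈ primesUpTo Q, Real.log p / p := ⟨_, rfl⟩
  obtain ⟨ρ, hρ⟩ : ∃ ρ : ℝ, ρ = ∑ p ∈ primesUpTo Q \ B, Real.log p / p := ⟨_, rfl⟩
  rw [← hσ] at hB1 hB4 ⊢
  rw [← hτ] at hB4 hK1
  rw [← hρ] at hB2 hB4
  have hmain : Z ^ 2 / α * (τ + ε * σ) ≤ Z ^ 2 / α * (α * (Real.log N + Real.log 4)) := by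
    have e : Z ^ 2 / α * (α * (Real.log N + Real.log 4)) =
        Z ^ 2 * Real.log N + Real.log 4 * Z ^ 2 := by
      field_simp
    rw [e, ← hB4]
    linarith
  have := le_of_mul_le_mul_left hmain (by positivity)
  linarith

/-- Many primes of size about `N ^ (1 / 4)` see `A` as nearly uniform on its progression. -/
lemma card_good_primes_ge {K : ℝ} (hK1 : 1 ≤ K)
    (hK : ∀ x : ℝ, 1 ≤ x →
      Real.log x - K ≤ ∑ p ∈ primesUpTo x, Real.log p / p ∧
      ∑ p ∈ primesUpTo x, Real.log p / p ≤ Real.log x + K ∧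
      ∑ p ∈ primesUpTo x, Real.log p / (p : ℝ) ^ 2 ≤ K)
    {A : Finset ℕ} {N : ℕ} {α : ℝ} (hA : A ⊆ Finset.Icc 1 N) (hα1 : 1 / 3 ≤ α)
    (hα2 : α ≤ 1 / 2) (hN : 0 < N) (hlog : 10 ^ 30 * K ≤ Real.log N)
    (hZ : (N : ℝ) ^ (α - 1 / 10 ^ 8) ≤ A.card)
    (hAP : ∀ p : ℕ, p.Prime → (p : ℝ) ≤ (N : ℝ) ^ α → InAP (modImage A p) (α * p)) :
    1 / 500 * (N : ℝ) ^ (1 / 4 - 1 / 250 : ℝ) ≤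
      ((primesUpTo ((N : ℝ) ^ (1 / 4 : ℝ))).filter fun p : ℕ =>
        (N : ℝ) ^ (1 / 4 - 1 / 250 : ℝ) < p ∧
        (collisions A p : ℝ) ≤ (1 + 1 / 40000) / (α * p) * (A.card : ℝ) ^ 2).card := by
  obtain ⟨l, hl⟩ : ∃ l, l = Real.log N := ⟨_, rfl⟩
  have hN1 : (1 : ℝ) ≤ N := by exact_mod_cast hN
  have hN0 : (0 : ℝ) < N := by linarith
  have hl0 : 0 < l := by rw [hl]; linarith
  obtain ⟨Q, hQ⟩ : ∃ Q, Q = (N : ℝ) ^ (α - 1 / 10 ^ 8) := ⟨_, rfl⟩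
  obtain ⟨X, hX⟩ : ∃ X, X = (N : ℝ) ^ (1 / 4 : ℝ) := ⟨_, rfl⟩
  obtain ⟨Y, hY⟩ : ∃ Y, Y = (N : ℝ) ^ (1 / 4 - 1 / 250 : ℝ) := ⟨_, rfl⟩
  have hQ1 : 1 ≤ Q := by rw [hQ]; exact Real.one_le_rpow hN1 (by linarith)
  have hX1 : 1 ≤ X := by rw [hX]; exact Real.one_le_rpow hN1 (by norm_num)
  have hY1 : 1 ≤ Y := by rw [hY]; exact Real.one_le_rpow hN1 (by norm_num)
  have hXQ : X ≤ Q := by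
    rw [hX, hQ]
    exact Real.rpow_le_rpow_of_exponent_le hN1 (by linarith)
  have hQα : Q ≤ (N : ℝ) ^ α := by
    rw [hQ]
    exact Real.rpow_le_rpow_of_exponent_le hN1 (by linarith)
  have hlogQ : Real.log Q = (α - 1 / 10 ^ 8) * l := by rw [hQ, Real.log_rpow hN0, hl]
  have hlogX : Real.log X = 1 / 4 * l := by rw [hX, Real.log_rpow hN0, hl]
  have hlogY : Real.log Y = (1 / 4 - 1 / 250) * l := by rw [hY, Real.log_rpow hN0, hl]
  rw [← hX, ← hY]
  rw [← hQ] at hZ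
  rw [← hl] at hlog
  obtain ⟨G, hG⟩ : ∃ G, G = (primesUpTo X).filter fun p : ℕ =>
    Y < p ∧ (collisions A p : ℝ) ≤ (1 + 1 / 40000) / (α * p) * (A.card : ℝ) ^ 2 := ⟨_, rfl⟩
  obtain ⟨B, hB⟩ : ∃ B, B = (primesUpTo X).filter fun p : ℕ =>
    ¬ (collisions A p : ℝ) ≤ (1 + 1 / 40000) / (α * p) * (A.card : ℝ) ^ 2 := ⟨_, rfl⟩
  have hbad := sum_log_div_bad_primes_le (α := α) (ε := 1 / 40000) hK hA (by linarith) hQ1 hZ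
    (fun p hp => by
      obtain ⟨hpp, hpQ⟩ := mem_primesUpTo.1 hp
      exact (hAP p hpp (hpQ.trans hQα)).card_le)
    (B := B) (fun p hp => by
      rw [hB, Finset.mem_filter, mem_primesUpTo] at hp
      exact mem_primesUpTo.2 ⟨hp.1.1, hp.1.2.trans hXQ⟩)
    (fun p hp => by
      rw [hB, Finset.mem_filter] at hp
      exact (not_le.1 hp.2).le)
  rw [hlogQ, ← hl] at hbad
  have hsub : primesUpTo X ⊆ primesUpTo Y ∪ (B ∪ G) := by
    intro p hp
    rw [Finset.mem_union, Finset.mem_union, hB, hG, Finset.mem_filter, Finset.mem_filter]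
    by_cases h1 : (p : ℝ) ≤ Y
    · exact Or.inl (mem_primesUpTo.2 ⟨(mem_primesUpTo.1 hp).1, h1⟩)
    · by_cases h2 : (collisions A p : ℝ) ≤ (1 + 1 / 40000) / (α * p) * (A.card : ℝ) ^ 2
      · exact Or.inr (Or.inr ⟨hp, not_le.1 h1, h2⟩)
      · exact Or.inr (Or.inl ⟨hp, h2⟩)
  have hnn : ∀ p : ℕ, 0 ≤ Real.log p / p := fun p =>
    div_nonneg (Real.log_natCast_nonneg p) (Nat.cast_nonneg p)
  have hsplit : ∑ p ∈ primesUpTo X, Real.log p / p ≤ ∑ p ∈ primesUpTo Y, Real.log p / p +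
      (∑ p ∈ B, Real.log p / p + ∑ p ∈ G, Real.log p / p) := by
    refine (Finset.sum_le_sum_of_subset_of_nonneg hsub fun p _ _ => hnn p).trans ?_
    have hun : ∀ S T : Finset ℕ, ∑ p ∈ S ∪ T, Real.log p / p ≤
        ∑ p ∈ S, Real.log p / p + ∑ p ∈ T, Real.log p / p := fun S T => by
      rw [← Finset.sum_union_inter]
      exact le_add_of_nonneg_right (Finset.sum_nonneg fun p _ => hnn p)
    exact (hun _ _).trans (add_le_add_right (hun _ _) _)
  have hGsum : ∑ p ∈ G, Real.log p / p ≤ G.card * (l / Y) := by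
    rw [← nsmul_eq_mul]
    refine Finset.sum_le_card_nsmul _ _ _ fun p hp => ?_
    rw [hG, Finset.mem_filter, mem_primesUpTo] at hp
    obtain ⟨⟨hpp, hpX⟩, hYp, -⟩ := hp
    have hp0 : (0 : ℝ) < p := by exact_mod_cast hpp.pos
    have h1 := Real.log_le_log hp0 hpX
    rw [hlogX] at h1
    apply div_le_div₀ hl0.le (by linarith) (by linarith) hYp.le
  have hXl := (hK X hX1).1
  have hYu := (hK Y hY1).2.1
  rw [hlogX] at hXl
  rw [hlogY] at hYu
  have hl4 : Real.log 4 ≤ 2 := by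
    rw [show (4 : ℝ) = 2 ^ 2 by norm_num, Real.log_pow]
    have := Real.log_two_lt_d9
    push_cast
    linarith
  have hαl4 : α * Real.log 4 ≤ 1 := by
    have : 0 < Real.log 4 := Real.log_pos (by norm_num)
    nlinarith
  rw [← hG]
  have hgl : 1 / 500 * l ≤ G.card * (l / Y) := by
    refine le_trans ?_ hGsum
    linarith
  rw [mul_div_assoc', le_div_iff₀ (by linarith)] at hgl
  refine le_of_mul_le_mul_right ?_ hl0
  linarith

lemma card_fibre_le {K : ℝ} (hK1 : 1 ≤ K)
    (hK : ∀ x : ℝ, 1 ≤ x →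
      Real.log x - K ≤ ∑ p ∈ primesUpTo x, Real.log p / p ∧
      ∑ p ∈ primesUpTo x, Real.log p / p ≤ Real.log x + K ∧
      ∑ p ∈ primesUpTo x, Real.log p / (p : ℝ) ^ 2 ≤ K)
    {A : Finset ℕ} {N k : ℕ} {α : ℝ} (hA : A ⊆ Finset.Icc 1 N) (hα1 : 1 / 3 ≤ α)
    (hα2 : α ≤ 1 / 2) (hN : 0 < N) (hlog : 10 ^ 30 * K ≤ Real.log N)
    (hk3 : 3 ≤ k) (hk5 : k ≤ 5) (hkα : k * α ≤ 2)
    (hAP : ∀ p : ℕ, p.Prime → (p : ℝ) ≤ (N : ℝ) ^ α → InAP (modImage A p) (α * p)) (y : ℤ) :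
    ((fibre A k y).card : ℝ) ≤ (N : ℝ) ^ (101 / 100 * (2 * α / k)) := by
  obtain ⟨β, hβ⟩ : ∃ β, β = 2 * α / k := ⟨_, rfl⟩
  have hN1 : (1 : ℝ) ≤ N := by exact_mod_cast hN
  have hk3' : (3 : ℝ) ≤ k := by exact_mod_cast hk3
  have hk5' : (k : ℝ) ≤ 5 := by exact_mod_cast hk5
  have hk0 : (0 : ℝ) < k := by linarith
  have hβk : β * k = 2 * α := by rw [hβ]; field_simp
  have hβlow : 2 / 15 ≤ β := by
    rw [hβ, le_div_iff₀ hk0]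
    linarith
  have hβup : β ≤ 2 * α / 3 := by
    rw [hβ]
    exact div_le_div_of_nonneg_left (by linarith) (by norm_num) hk3'
  rw [← hβ]
  have hβ0 : 0 < β := by linarith
  refine card_le_of_card_modImage_le (B := fibre A k y) hK ((Finset.filter_subset _ _).trans hA)
    (Real.one_le_rpow hN1 (by linarith)) hβ0 ?_ ?_
  · intro p hp hpT
    have hpα : (p : ℝ) ≤ (N : ℝ) ^ α :=
      hpT.trans (Real.rpow_le_rpow_of_exponent_le hN1 (by linarith))
    obtain ⟨L, x, d, hd, hL, hsub⟩ := hAP p hp hpα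
    have hp0 : (0 : ℝ) < p := by exact_mod_cast hp.pos
    have hLp : L ≤ p := by
      have : (L : ℝ) ≤ p := by nlinarith
      exact_mod_cast this
    have hkL : k * L ≤ 2 * p := by
      have : (k : ℝ) * L ≤ 2 * p := by nlinarith
      exact_mod_cast this
    have h := card_modImage_fibre_le hp (by omega) hd hLp hkL hsub y
    have h2 : 2 * (L : ℝ) / k ≤ β * p := by
      rw [div_le_iff₀ hk0]
      nlinarith
    linarith
  · rw [Real.log_rpow (by linarith)]
    obtain ⟨l, hl⟩ : ∃ l, l = Real.log N := ⟨_, rfl⟩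
    rw [← hl] at hlog ⊢
    have hl4 : Real.log 4 ≤ 2 := by
      rw [show (4 : ℝ) = 2 ^ 2 by norm_num, Real.log_pow]
      have := Real.log_two_lt_d9
      push_cast
      linarith
    have e : (101 / 100 * β * l - K) / β = 101 / 100 * l - K / β := by
      field_simp
    have e1 : K / β ≤ K * 8 := by
      rw [div_le_iff₀ hβ0]
      nlinarith
    have e2 : 4 * K / β ^ 2 ≤ K * 400 := by
      have hβ2 : (2 / 15) ^ 2 ≤ β ^ 2 := pow_le_pow_left₀ (by norm_num) hβlow 2
      rw [div_le_iff₀ (by positivity)]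
      nlinarith
    rw [e]
    linarith

/-- The core contradiction, for a dilation factor `k` adapted to `α`. -/
lemma card_le_rpow_of_inAP {K : ℝ} (hK1 : 1 ≤ K)
    (hK : ∀ x : ℝ, 1 ≤ x →
      Real.log x - K ≤ ∑ p ∈ primesUpTo x, Real.log p / p ∧
      ∑ p ∈ primesUpTo x, Real.log p / p ≤ Real.log x + K ∧
      ∑ p ∈ primesUpTo x, Real.log p / (p : ℝ) ^ 2 ≤ K)
    {A : Finset ℕ} {N k : ℕ} {α : ℝ} (hA : A ⊆ Finset.Icc 1 N) (hα1 : 1 / 3 ≤ α)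
    (hα2 : α ≤ 1 / 2) (hN : 0 < N) (hlog : 10 ^ 30 * K ≤ Real.log N)
    (hk3 : 3 ≤ k) (hk5 : k ≤ 5) (hkα1 : 1 + 1 / 20 ≤ k * α) (hkα2 : k * α ≤ 1 + 24 / 25)
    (hexp : 514 / 1000 + 101 / 100 * (2 * α / k) ≤ 2 * α)
    (hAP : ∀ p : ℕ, p.Prime → (p : ℝ) ≤ (N : ℝ) ^ α → InAP (modImage A p) (α * p)) :
    (A.card : ℝ) ≤ (N : ℝ) ^ (α - 1 / 10 ^ 8) := by
  by_contra hlt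
  have hZ := (not_le.1 hlt).le
  have hN1 : (1 : ℝ) ≤ N := by exact_mod_cast hN
  have hN0 : (0 : ℝ) < N := by linarith
  have hgood := card_good_primes_ge hK1 hK hA hα1 hα2 hN hlog hZ hAP
  have hT := card_fibre_le hK1 hK hA hα1 hα2 hN hlog hk3 hk5 (by linarith) hAP
  obtain ⟨P, hP⟩ : ∃ P, P = (primesUpTo ((N : ℝ) ^ (1 / 4 : ℝ))).filter fun p : ℕ =>
        (N : ℝ) ^ (1 / 4 - 1 / 250 : ℝ) < p ∧
        (collisions A p : ℝ) ≤ (1 + 1 / 40000) / (α * p) * (A.card : ℝ) ^ 2 := ⟨_, rfl⟩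
  rw [← hP] at hgood
  have hAcard : 0 < A.card := by
    have : (0 : ℝ) < A.card := lt_of_lt_of_le (by positivity) hZ
    exact_mod_cast this
  have hPcard : 0 < P.card := by
    have : (0 : ℝ) < P.card := lt_of_lt_of_le (by positivity) hgood
    exact_mod_cast this
  have hPprop : ∀ p ∈ P, p.Prime ∧ 2 < p ∧ p ^ 4 ≤ N := by
    intro p hp
    rw [hP, Finset.mem_filter, mem_primesUpTo] at hp
    obtain ⟨⟨hpp, hpX⟩, hYp, -⟩ := hp
    refine ⟨hpp, ?_, ?_⟩
    · have h1 : (2 : ℝ) ≤ (N : ℝ) ^ (1 / 4 - 1 / 250 : ℝ) := by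
        rw [rpow_eq_exp_mul_log hN]
        have := Real.add_one_le_exp ((1 / 4 - 1 / 250 : ℝ) * Real.log N)
        linarith
      exact_mod_cast lt_of_le_of_lt h1 hYp
    · have h1 : (p : ℝ) ^ 4 ≤ ((N : ℝ) ^ (1 / 4 : ℝ)) ^ 4 :=
        pow_le_pow_left₀ (Nat.cast_nonneg p) hpX 4
      rw [← Real.rpow_natCast, ← Real.rpow_natCast, ← Real.rpow_mul hN0.le] at h1
      norm_num at h1
      exact_mod_cast h1
  have hbias : ∀ p : ℕ, ∃ b : ℕ, p ∈ P → 0 < b ∧ b < p ∧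
      1 / 200 * (A.card : ℝ) ≤ ‖expSum A (b / p)‖ ∧
      1 / 200 * (A.card : ℝ) ≤ ‖expSum A (k * (b / p))‖ := by
    intro p
    by_cases hp : p ∈ P
    · have hp' := hp
      rw [hP, Finset.mem_filter, mem_primesUpTo] at hp'
      obtain ⟨⟨hpp, hpX⟩, -, hcoll⟩ := hp'
      obtain ⟨b, hb0, hbp, hb⟩ := exists_biased_frequency hpp hα1 hα2 hAcard
        (hAP p hpp (hpX.trans (Real.rpow_le_rpow_of_exponent_le hN1 (by linarith)))) hcoll
      refine ⟨b, fun _ => ⟨hb0, hbp, ?_, ?_⟩⟩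
      · have := hb 1 0 one_pos (by push_cast; linarith) (by push_cast; linarith)
          (by push_cast; linarith)
        rwa [Nat.cast_one, one_mul] at this
      · exact hb k 1 (by omega) (by linarith) (by push_cast; linarith) (by push_cast; linarith)
    · exact ⟨0, fun h => absurd h hp⟩
  choose b hb using hbias
  have hmain := biased_frequencies_bound (κ := 1 / 200) hA (by norm_num) hT hN hAcard hPcard
    (b := b) (fun p hp => ⟨(hPprop p hp).1, (hPprop p hp).2.1, (hPprop p hp).2.2,
      (hb p hp).1, (hb p hp).2.1⟩) (fun p hp => (hb p hp).2.2.1) (fun p hp => (hb p hp).2.2.2)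
  obtain ⟨l, hl⟩ : ∃ l, l = Real.log N := ⟨_, rfl⟩
  have hNexp : (N : ℝ) = Real.exp l := by rw [hl, Real.exp_log hN0]
  obtain ⟨γ, hγ⟩ : ∃ γ, γ = 101 / 100 * (2 * α / k) := ⟨_, rfl⟩
  rw [← hγ] at hmain hexp
  rw [rpow_eq_exp_mul_log hN, ← hl] at hmain hgood hZ
  rw [← hl] at hlog
  have hl0 : 0 < l := by linarith
  have hk5' : (k : ℝ) ≤ 5 := by exact_mod_cast hk5
  have hZ2 : Real.exp (2 * ((α - 1 / 10 ^ 8) * l)) ≤ (A.card : ℝ) ^ 2 := by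
    have := pow_le_pow_left₀ (Real.exp_pos _).le hZ 2
    rwa [← Real.exp_nat_mul, Nat.cast_ofNat] at this
  have hg2 : 1 / 500 ^ 2 * Real.exp (2 * ((1 / 4 - 1 / 250) * l)) ≤ (P.card : ℝ) ^ 2 := by
    have := pow_le_pow_left₀ (mul_pos (by norm_num) (Real.exp_pos _)).le hgood 2
    rwa [mul_pow, ← Real.exp_nat_mul, Nat.cast_ofNat, one_div_pow] at this
  have hlow : (1 / 200) ^ 8 * Real.exp (2 * ((α - 1 / 10 ^ 8) * l)) *
      (1 / 500 ^ 2 * Real.exp (2 * ((1 / 4 - 1 / 250) * l))) ≤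
      Real.exp (γ * l) * (Real.exp l * (4 * l)) := by
    calc _ ≤ (1 / 200) ^ 8 * (A.card : ℝ) ^ 2 * (P.card : ℝ) ^ 2 :=
          mul_le_mul (mul_le_mul_of_nonneg_left hZ2 (by norm_num)) hg2
            (mul_pos (by norm_num) (Real.exp_pos _)).le
            (mul_nonneg (by norm_num) (sq_nonneg _))
      _ ≤ _ := hmain
      _ ≤ _ := by
        rw [hNexp]
        gcongr
        linarith
  have hE : Real.exp (γ * l) * Real.exp l * Real.exp (l / 200) ≤
      Real.exp (2 * ((α - 1 / 10 ^ 8) * l)) * Real.exp (2 * ((1 / 4 - 1 / 250) * l)) := by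
    rw [← Real.exp_add, ← Real.exp_add, ← Real.exp_add]
    apply Real.exp_le_exp.2
    nlinarith
  have hq := Real.quadratic_le_exp_of_nonneg (x := l / 200) (by positivity)
  have hF : 0 < Real.exp (γ * l) * Real.exp l := by positivity
  have hfin : Real.exp (l / 200) ≤ 200 ^ 8 * 500 ^ 2 * (4 * l) := by
    refine le_of_mul_le_mul_left ?_ hF
    refine hE.trans ?_
    have := mul_le_mul_of_nonneg_left hlow (show (0 : ℝ) ≤ 200 ^ 8 * 500 ^ 2 by norm_num)
    calc _ = 200 ^ 8 * 500 ^ 2 * ((1 / 200) ^ 8 * Real.exp (2 * ((α - 1 / 10 ^ 8) * l)) *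
          (1 / 500 ^ 2 * Real.exp (2 * ((1 / 4 - 1 / 250) * l)))) := by ring
      _ ≤ _ := this
      _ = _ := by ring
  nlinarith

theorem sieve_ap_simple :
    ∃ (c C : ℝ), c > 0 ∧ C > 0 ∧ ∃ N₀ : ℕ, ∀ N : ℕ, N ≥ N₀ →
      ∀ α : ℝ, 1/3 ≤ α → α ≤ 1/2 →
        ∀ A : Finset ℕ, A ⊆ Finset.Icc 1 N →
          (∀ p : ℕ, p.Prime → (p : ℝ) ≤ (N : ℝ) ^ α →
            InAP (modImage A p) (α * p)) →
          (A.card : ℝ) ≤ C * (N : ℝ) ^ (α - c) := by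
  obtain ⟨K, hK1, hK⟩ := exists_mertens_constant
  refine ⟨1 / 10 ^ 8, 1, by norm_num, one_pos, ⌈Real.exp (10 ^ 30 * K)⌉₊, ?_⟩
  intro N hN α hα1 hα2 A hA hAP
  have hNR : Real.exp (10 ^ 30 * K) ≤ N := Nat.ceil_le.1 hN
  have hN0 : (0 : ℝ) < N := (Real.exp_pos _).trans_le hNR
  have hlog : 10 ^ 30 * K ≤ Real.log N := (Real.le_log_iff_exp_le hN0).2 hNR
  have hN0' : 0 < N := by exact_mod_cast hN0
  rw [one_mul]
  rcases le_total α (39 / 100) with h | h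
  · exact card_le_rpow_of_inAP (k := 5) hK1 hK hA hα1 hα2 hN0' hlog (by norm_num) (by norm_num)
      (by push_cast; linarith) (by push_cast; linarith) (by push_cast; linarith) hAP
  · exact card_le_rpow_of_inAP (k := 3) hK1 hK hA hα1 hα2 hN0' hlog (by norm_num) (by norm_num)
      (by push_cast; linarith) (by push_cast; linarith) (by push_cast; linarith) hAP
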